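/- Assume R is unmixed of dimension d ≥ 2. Then Ξ_1(R) ⊆ (−∞, N(R)], that is, e_1(q :_R m, R) ≤ N(R) for every C-parameter ideal q of R. -/

import Mathlib

/-! Preliminary definitions: lengths, dimensions, (C-)systems of parameters, Hilbert
coefficients, irreducible multiplicities, local cohomology invariants, stable values,
unmixedness, the unmixed component, and the g-invariant. -/

open CategoryTheory CategoryTheory.Limits Opposite IsLocalRing

universe u

noncomputable section

section Definitions

variable (R : Type u) [CommRing R]

/-- The length of an `R`-module, defined as the Krull dimension of its submodule lattice. -/
def moduleLength (M : Type u) [AddCommGroup M] [Module R M] : WithBot ℕ∞ :=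
  Order.krullDim (Submodule R M)

/-- The Krull dimension of an `R`-module `M`, i.e. `dim (R / Ann M)`. -/
def moduleDim (M : Type u) [AddCommGroup M] [Module R M] : WithBot ℕ∞ :=
  ringKrullDim (R ⧸ Module.annihilator R M)

/-- The colon submodule `(N :_M I) = {x : M | I • x ⊆ N}`. -/
def modColon {M : Type u} [AddCommGroup M] [Module R M] (N : Submodule R M) (I : Ideal R) :
    Submodule R M where
  carrier := {x | ∀ r ∈ I, r • x ∈ N}
  add_mem' := by
    intro a b ha hb r hr
    simpa [smul_add] using N.add_mem (ha r hr) (hb r hr)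
  zero_mem' := by
    intro r hr
    simpa using N.zero_mem
  smul_mem' := by
    intro c a ha r hr
    rw [smul_comm]
    exact N.smul_mem c (ha r hr)

/-- `x : Fin s → R` is a system of parameters of the module `M`:
`s = dim M`, the `x i` are nonunits, and `M/(x)M` has finite length. -/
def IsSOP (M : Type u) [AddCommGroup M] [Module R M] {s : ℕ} (x : Fin s → R) : Prop :=
  moduleDim R M = (s : WithBot ℕ∞) ∧ (∀ i, x i ∈ nonunits R) ∧
    IsFiniteLength R (M ⧸ (Ideal.span (Set.range x) • (⊤ : Submodule R M)))

/-- The ideal `b(M)`: the intersection, over all systems of parameters `x` of `M` and all `i`,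
of `Ann_R ((0) :_{M/(x_1,...,x_{i-1})M} x_i)`. -/
def bIdeal (M : Type u) [AddCommGroup M] [Module R M] : Ideal R :=
  ⨅ (s : ℕ) (x : Fin s → R) (_ : IsSOP R M x) (i : Fin s),
    (Submodule.torsionBy R
      (M ⧸ (Ideal.span (x '' {j | j < i}) • (⊤ : Submodule R M))) (x i)).annihilator

/-- `x` is a C-system of parameters of `M`: a system of parameters such that
`x i ∈ b(M/(x_{i+1},...,x_s)M)^3` for every `i` (for `i = s` the quotient is `M` itself). -/
def IsCSOP (M : Type u) [AddCommGroup M] [Module R M] {s : ℕ} (x : Fin s → R) : Prop :=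
  IsSOP R M x ∧ ∀ i : Fin s,
    x i ∈ (bIdeal R (M ⧸ (Ideal.span (x '' {j | i < j}) • (⊤ : Submodule R M)))) ^ 3

/-- A parameter ideal of `R`. -/
def IsParamIdeal (q : Ideal R) : Prop :=
  ∃ (s : ℕ) (x : Fin s → R), IsSOP R R x ∧ q = Ideal.span (Set.range x)

/-- A C-parameter ideal of `R`: an ideal generated by a C-system of parameters of `R`. -/
def IsCParamIdeal (q : Ideal R) : Prop :=
  ∃ (s : ℕ) (x : Fin s → R), IsCSOP R R x ∧ q = Ideal.span (Set.range x)

/-- A C-parameter ideal of a module `M`. -/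
def IsCParamIdealMod (M : Type u) [AddCommGroup M] [Module R M] (q : Ideal R) : Prop :=
  ∃ (s : ℕ) (x : Fin s → R), IsCSOP R M x ∧ q = Ideal.span (Set.range x)

/-- `e` is the family of Hilbert coefficients of `M` (of dimension `s`) with respect to `I`:
`ℓ(M/I^{n+1}M) = ∑_{i=0}^{s} (-1)^i (e i) binom(n+s-i, s-i)` for all large `n`. -/
def IsHilbCoeffMod (I : Ideal R) (M : Type u) [AddCommGroup M] [Module R M] (s : ℕ)
    (e : ℕ → ℤ) : Prop :=
  ∃ N : ℕ, ∀ n ≥ N, ∃ L : ℕ,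
    moduleLength R (M ⧸ (I ^ (n + 1) • (⊤ : Submodule R M))) = (L : WithBot ℕ∞) ∧
    (L : ℤ) = ∑ i ∈ Finset.range (s + 1),
      (-1) ^ i * e i * ((n + s - i).choose (s - i) : ℤ)

/-- `e` is the family of Hilbert coefficients of `R` (of dimension `d`) with respect to `I`;
`e 1` is the Chern number of `I`. -/
def IsHilbCoeff (I : Ideal R) (d : ℕ) (e : ℕ → ℤ) : Prop :=
  IsHilbCoeffMod R I R d e

variable [IsLocalRing R]

/-- The colon ideal `(q :_R m)`. -/
def colonIdeal (q : Ideal R) : Ideal R :=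
  modColon R q (maximalIdeal R)

/-- The index of reducibility `ir_M(q) = ℓ((qM :_M m)/qM)`. -/
def irMod (M : Type u) [AddCommGroup M] [Module R M] (q : Ideal R) : WithBot ℕ∞ :=
  moduleLength R
    ↥(Submodule.map (q • (⊤ : Submodule R M)).mkQ
      (modColon R (q • (⊤ : Submodule R M)) (maximalIdeal R)))

/-- `NN` is the stable value `𝒩(M)` of `M`: the common index of reducibility of all
C-parameter ideals of `M`. -/
def IsStableValueMod (M : Type u) [AddCommGroup M] [Module R M] (NN : ℕ) : Prop :=
  ∀ q : Ideal R, IsCParamIdealMod R M q → irMod R M q = (NN : WithBot ℕ∞)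

/-- `NN` is the stable value `𝒩(R)` of `R`. -/
def IsStableValue (NN : ℕ) : Prop :=
  ∀ q : Ideal R, IsCParamIdeal R q → irMod R R q = (NN : WithBot ℕ∞)

/-- `f` is the family of coefficients of the polynomial giving the index of reducibility,
`ir_M(I^{n+1}) = ℓ((I^{n+1}M :_M m)/I^{n+1}M) = ∑_{i=0}^{s-1} (-1)^i (f i) binom(n+s-1-i, s-1-i)`
for all large `n`; `f 0` is the irreducible multiplicity of `M` with respect to `I`. -/
def IsIrrCoeffMod (I : Ideal R) (M : Type u) [AddCommGroup M] [Module R M] (s : ℕ)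
    (f : ℕ → ℤ) : Prop :=
  ∃ N : ℕ, ∀ n ≥ N, ∃ L : ℕ,
    irMod R M (I ^ (n + 1)) = (L : WithBot ℕ∞) ∧
    (L : ℤ) = ∑ i ∈ Finset.range s,
      (-1) ^ i * f i * ((n + s - 1 - i).choose (s - 1 - i) : ℤ)

/-- Ring version of `IsIrrCoeffMod`. -/
def IsIrrCoeff (I : Ideal R) (d : ℕ) (f : ℕ → ℤ) : Prop :=
  IsIrrCoeffMod R I R d f

/-- The local cohomology module `H^i_m(M)`. -/
def Hmod (M : Type u) [AddCommGroup M] [Module R M] (i : ℕ) : ModuleCat.{u} R :=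
  (localCohomology (maximalIdeal R) i).obj (ModuleCat.of R M)

/-- `r_i(M) = ℓ((0) :_{H^i_m(M)} m)`, the length of the socle of `H^i_m(M)`. -/
def rLengthMod (M : Type u) [AddCommGroup M] [Module R M] (i : ℕ) : WithBot ℕ∞ :=
  moduleLength R ↥(Submodule.torsionBySet R ↥(Hmod R M i) ((maximalIdeal R : Ideal R) : Set R))

/-- `r_i(R)`. -/
def rLength (i : ℕ) : WithBot ℕ∞ := rLengthMod R R i

/-- `M` is a Cohen-Macaulay `R`-module: `H^i_m(M) = 0` for all `i < dim M`. -/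
def IsCMMod (M : Type u) [AddCommGroup M] [Module R M] : Prop :=
  ∀ i : ℕ, (i : WithBot ℕ∞) < moduleDim R M → Subsingleton ↥(Hmod R M i)

/-- `R` is a Cohen-Macaulay local ring: `H^i_m(R) = 0` for all `i < dim R`. -/
def IsCMLocal : Prop :=
  ∀ i : ℕ, (i : WithBot ℕ∞) < ringKrullDim R → Subsingleton ↥(Hmod R R i)

/-- `R` is a generalized Cohen-Macaulay local ring:
`H^i_m(R)` has finite length for all `i < dim R`. -/
def IsGeneralizedCM : Prop :=
  ∀ i : ℕ, (i : WithBot ℕ∞) < ringKrullDim R → IsFiniteLength R ↥(Hmod R R i)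

/-- `R` is a Gorenstein local ring: Cohen-Macaulay of type `r_d(R) = 1`, `d = dim R`. -/
def IsGorensteinLocal : Prop :=
  IsCMLocal R ∧ ∀ d : ℕ, ringKrullDim R = (d : WithBot ℕ∞) → rLength R d = (1 : WithBot ℕ∞)

/-- `R` is unmixed: `dim R̂/p = dim R̂` for every associated prime `p` of the
`m`-adic completion `R̂` of `R`. -/
def IsUnmixedRing : Prop :=
  ∀ p ∈ associatedPrimes (AdicCompletion (maximalIdeal R) R) (AdicCompletion (maximalIdeal R) R),
    ringKrullDim ((AdicCompletion (maximalIdeal R) R) ⧸ p) =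
      ringKrullDim (AdicCompletion (maximalIdeal R) R)

/-- `M` is unmixed: `dim R̂/p = dim M̂` for every associated prime `p` of the
`m`-adic completion `M̂` of `M`, viewed over `R̂`. -/
def IsUnmixedMod (M : Type u) [AddCommGroup M] [Module R M] : Prop :=
  ∀ p ∈ associatedPrimes (AdicCompletion (maximalIdeal R) R) (AdicCompletion (maximalIdeal R) M),
    ringKrullDim ((AdicCompletion (maximalIdeal R) R) ⧸ p) =
      moduleDim (AdicCompletion (maximalIdeal R) R) (AdicCompletion (maximalIdeal R) M)

/-- `H^0_m(M)`, described as the submodule of elements killed by a power of `m`. -/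
def H0Sub (M : Type u) [AddCommGroup M] [Module R M] : Submodule R M :=
  ⨆ n : ℕ, Submodule.torsionBySet R M (((maximalIdeal R) ^ n : Ideal R) : Set R)

/-- The unmixed component `u = U_R(0)` of `R`: the largest ideal of dimension `< dim R`. -/
def unmixedComponent : Ideal R := sSup {J : Ideal R | moduleDim R ↥J < ringKrullDim R}

end Definitions

section CMImage

/-- `R` is a homomorphic image of a Cohen-Macaulay (Noetherian) local ring. -/
def IsHomImageOfCM (R : Type u) [CommRing R] : Prop :=
  ∃ (A : Type u) (_ : CommRing A) (_ : IsLocalRing A) (_ : IsNoetherianRing A),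
    IsCMLocal A ∧ ∃ f : A →+* R, Function.Surjective f

end CMImage

section GInvariant

variable (R : Type u) [CommRing R] [IsLocalRing R] [IsNoetherianRing R]

/-- The canonical homomorphism from `Ext^p(R/q, R)` (the term of the directed system indexed by
the ideal `q` with `J ≤ rad q`) into the local cohomology module `H^p_J(R)`, given by the
structure of `H^p_J(R)` as an inductive limit. -/
def canonicalToLocalCohomology (J q : Ideal R) (h : J ≤ q.radical) (p : ℕ) :
    ((localCohomology.diagram (localCohomology.selfLERadicalDiagram J) p).obj
        (op (⟨q, h⟩ : localCohomology.SelfLERadical J))).obj (ModuleCat.of R R) ⟶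
      (localCohomology J p).obj (ModuleCat.of R R) :=
  haveI := localCohomology.hasColimitDiagram.{u, u} (localCohomology.selfLERadicalDiagram J) p
  (colimit.ι (localCohomology.diagram (localCohomology.selfLERadicalDiagram J) p)
      (op (⟨q, h⟩ : localCohomology.SelfLERadical J))).app (ModuleCat.of R R) ≫
    (localCohomology.isoSelfLERadical J p).hom.app (ModuleCat.of R R)

/-- A map of `R`-modules is surjective on socles. -/
def SurjectiveOnSocles {A B : ModuleCat.{u} R} (φ : A ⟶ B) : Prop :=
  ∀ y ∈ Submodule.torsionBySet R ↥B ((maximalIdeal R : Ideal R) : Set R),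
    ∃ z ∈ Submodule.torsionBySet R ↥A ((maximalIdeal R : Ideal R) : Set R), φ z = y

/-- The defining property of the g-invariant: for every system of parameters `x` of `R`
contained in `m^(n₀)` and every `p`, the canonical homomorphism into the local cohomology
module `H^p_m(R)` is surjective on the socles. -/
def GProperty (n₀ : ℕ) : Prop :=
  ∀ (s : ℕ) (x : Fin s → R), IsSOP R R x → (∀ i, x i ∈ maximalIdeal R ^ n₀) →
    ∀ (h : maximalIdeal R ≤ (Ideal.span (Set.range x)).radical) (p : ℕ),
      SurjectiveOnSocles R
        (canonicalToLocalCohomology R (maximalIdeal R) (Ideal.span (Set.range x)) h p)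

/-- The g-invariant `g(R)`: the least `n₀` satisfying `GProperty`. -/
def gInvariant : ℕ := sInf {n₀ : ℕ | GProperty R n₀}

end GInvariant

end

section Colength

variable {R : Type*} [CommRing R]

/-- The length of `R ⧸ I`. -/
noncomputable def colen (I : Ideal R) : ℕ∞ := Module.length R (R ⧸ I)

theorem colen_anti {I J : Ideal R} (h : I ≤ J) : colen J ≤ colen I :=
  Module.length_le_of_surjective (Submodule.factor h) (Submodule.factor_surjective h)

theorem colen_top : colen (⊤ : Ideal R) = 0 := by
  unfold colen
  rw [Module.length_eq_zero_iff]
  exact Ideal.Quotient.subsingleton_iff.2 rfl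

theorem colen_eq_colon_add (J : Ideal R) (x : R) :
    colen J = colen (J.colon {x}) + colen (J ⊔ Ideal.span {x}) := by
  let f : (R ⧸ J.colon {x}) →ₗ[R] (R ⧸ J) :=
    Submodule.mapQ _ _ (LinearMap.mulLeft R x) (by
      intro c hc
      simpa [mul_comm] using hc)
  let g : (R ⧸ J) →ₗ[R] (R ⧸ J ⊔ Ideal.span {x}) := Submodule.factor le_sup_left
  refine Module.length_eq_add_of_exact f g ?_ (Submodule.factor_surjective _) ?_
  · rw [← LinearMap.ker_eq_bot, LinearMap.ker_eq_bot']
    intro c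
    obtain ⟨c, rfl⟩ := Submodule.Quotient.mk_surjective _ c
    intro h
    rw [Submodule.mapQ_apply, Submodule.Quotient.mk_eq_zero] at h
    rw [Submodule.Quotient.mk_eq_zero, Submodule.mem_colon_singleton]
    simpa [mul_comm] using h
  · intro c
    obtain ⟨c, rfl⟩ := Submodule.Quotient.mk_surjective _ c
    constructor
    · intro h
      have h' : c ∈ J ⊔ Ideal.span {x} := by
        rw [← Submodule.Quotient.mk_eq_zero]; exact h
      obtain ⟨j, hj, y, hy, rfl⟩ := Submodule.mem_sup.1 h'
      obtain ⟨a, rfl⟩ := Ideal.mem_span_singleton'.1 hy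
      refine ⟨Submodule.Quotient.mk a, ?_⟩
      rw [Submodule.mapQ_apply, Submodule.Quotient.eq]
      have : x * a - (j + a * x) = -j := by ring
      simpa [this] using hj
    · rintro ⟨a, ha⟩
      obtain ⟨a, rfl⟩ := Submodule.Quotient.mk_surjective _ a
      rw [← ha, Submodule.mapQ_apply]
      change Submodule.Quotient.mk _ = _
      rw [Submodule.Quotient.mk_eq_zero]
      exact Submodule.mem_sup_right (Ideal.mem_span_singleton'.2 ⟨a, mul_comm _ _⟩)

theorem colen_eq_length_map_add {A B : Ideal R} (h : A ≤ B) :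
    colen A = Module.length R (Submodule.map A.mkQ B) + colen B := by
  refine Module.length_eq_add_of_exact (Submodule.map A.mkQ B).subtype (Submodule.factor h)
    (Submodule.injective_subtype _) (Submodule.factor_surjective h) ?_
  intro c
  obtain ⟨c, rfl⟩ := Submodule.Quotient.mk_surjective _ c
  constructor
  · intro hc
    have hc' : c ∈ B := by rw [← Submodule.Quotient.mk_eq_zero]; exact hc
    exact ⟨⟨_, Submodule.mem_map_of_mem hc'⟩, rfl⟩
  · rintro ⟨⟨_, b, hb, rfl⟩, e⟩
    rw [← e]
    exact (Submodule.Quotient.mk_eq_zero _).2 hb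

theorem colen_sup_add_le {A B : Ideal R} (h : A ≤ B) (V : Ideal R) :
    colen (A ⊔ V) + colen B ≤ colen (B ⊔ V) + colen A := by
  rw [colen_eq_length_map_add h, colen_eq_length_map_add (sup_le_sup_right h V),
    add_comm _ (colen (B ⊔ V)), add_assoc]
  gcongr
  let f : (R ⧸ A) →ₗ[R] (R ⧸ A ⊔ V) := Submodule.factor le_sup_left
  have hf : Submodule.map f (Submodule.map A.mkQ B) = Submodule.map (A ⊔ V).mkQ (B ⊔ V) := by
    rw [← Submodule.map_comp]
    have : f ∘ₗ A.mkQ = (A ⊔ V).mkQ := rfl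
    rw [this, Submodule.map_sup]
    refine (sup_eq_left.2 ?_).symm
    rintro _ ⟨v, hv, rfl⟩
    have h0 : (A ⊔ V).mkQ v = 0 := (Submodule.Quotient.mk_eq_zero _).2 (Submodule.mem_sup_right hv)
    rw [h0]; exact zero_mem _
  rw [← hf]
  exact Module.length_le_of_surjective (f.submoduleMap _) (f.submoduleMap_surjective _)

variable [IsLocalRing R]

theorem colen_maximalIdeal : colen (maximalIdeal R) = 1 := by
  unfold colen
  rw [Module.length_eq_one_iff]
  exact isSimpleModule_iff_isCoatom.2 (Ideal.isMaximal_def.1 inferInstance)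

theorem isArtinianRing_quotient_iff [IsNoetherianRing R] {I : Ideal R} (hI : I ≠ ⊤) :
    IsArtinianRing (R ⧸ I) ↔ ∃ N, maximalIdeal R ^ N ≤ I := by
  refine ⟨fun _ ↦ exists_maximalIdeal_pow_le_of_isArtinianRing_quotient I, ?_⟩
  rintro ⟨N, hN⟩
  have : Nontrivial (R ⧸ I) := Ideal.Quotient.nontrivial_iff.2 hI
  have hloc : IsLocalRing (R ⧸ I) :=
    .of_surjective' (Ideal.Quotient.mk I) Ideal.Quotient.mk_surjective
  rw [isArtinianRing_iff_isNilpotent_maximalIdeal]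
  refine ⟨N, ?_⟩
  have h1 : (maximalIdeal R).map (Ideal.Quotient.mk I) = maximalIdeal (R ⧸ I) := by
    have := IsLocalHom.of_surjective (Ideal.Quotient.mk I) Ideal.Quotient.mk_surjective
    ext x
    obtain ⟨x, rfl⟩ := Ideal.Quotient.mk_surjective x
    simp [sup_eq_left.mpr (le_maximalIdeal hI)]
  rw [← h1, ← Ideal.map_pow, Ideal.zero_eq_bot, eq_bot_iff, Ideal.map_le_iff_le_comap]
  intro a ha
  simpa [Ideal.Quotient.eq_zero_iff_mem] using hN ha

theorem colen_ne_top [IsNoetherianRing R] {I : Ideal R} {N : ℕ} (h : maximalIdeal R ^ N ≤ I) :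
    colen I ≠ ⊤ := by
  by_cases hI : I = ⊤
  · simp [hI, colen_top]
  have := (isArtinianRing_quotient_iff hI).2 ⟨N, h⟩
  have : IsArtinian R (R ⧸ I) :=
    isArtinian_of_surjective_algebraMap (S := R) (R := R ⧸ I) Ideal.Quotient.mk_surjective
  exact Module.length_ne_top

theorem exists_pow_le_of_isFiniteLength [IsNoetherianRing R] {I : Ideal R}
    (h : IsFiniteLength R (R ⧸ I)) : ∃ N, maximalIdeal R ^ N ≤ I := by
  by_cases hI : I = ⊤
  · exact ⟨0, by simp [hI]⟩
  refine (isArtinianRing_quotient_iff hI).1 ?_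
  have := (isFiniteLength_iff_isNoetherian_isArtinian.1 h).2
  exact isArtinian_of_tower R this

end Colength

section Asymptotics

open Filter Topology

theorem tendsto_choose_div_choose_zero {d i j : ℕ} (hij : j < i) (hi : i ≤ d) :
    Tendsto (fun n : ℕ => ((n + d - i).choose (d - i) : ℝ) / ((n + d - j).choose (d - j) : ℝ))
      atTop (𝓝 0) := by
  induction i, hij using Nat.le_induction with
  | base =>
    have key : ∀ n : ℕ, ((n + d - (j + 1)).choose (d - (j + 1)) : ℝ) /
        ((n + d - j).choose (d - j) : ℝ) = ((d - j : ℕ) : ℝ) / ((n + (d - j) : ℕ) : ℝ) := by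
      intro n
      obtain ⟨k, rfl⟩ : ∃ k, d = j + 1 + k := ⟨d - (j + 1), by omega⟩
      have e1 : n + (j + 1 + k) - (j + 1) = n + k := by omega
      have e2 : j + 1 + k - (j + 1) = k := by omega
      have e3 : n + (j + 1 + k) - j = n + k + 1 := by omega
      have e4 : j + 1 + k - j = k + 1 := by omega
      rw [e1, e2, e3, e4]
      have h := Nat.add_one_mul_choose_eq (n + k) k
      have hpos : 0 < (n + k + 1).choose (k + 1) := Nat.choose_pos (by omega)
      rw [div_eq_div_iff (by positivity) (by positivity)]
      have h' := congrArg (Nat.cast : ℕ → ℝ) h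
      push_cast at h' ⊢
      linarith
    simp_rw [key]
    refine Tendsto.div_atTop tendsto_const_nhds ?_
    exact tendsto_natCast_atTop_atTop.comp (tendsto_add_atTop_nat _)
  | succ i hij ih =>
    have h1 := ih (by omega)
    have key : ∀ n : ℕ, ((n + d - (i + 1)).choose (d - (i + 1)) : ℝ) ≤
        ((n + d - i).choose (d - i) : ℝ) := by
      intro n
      obtain ⟨k, rfl⟩ : ∃ k, d = i + 1 + k := ⟨d - (i + 1), by omega⟩
      have e1 : n + (i + 1 + k) - (i + 1) = n + k := by omega
      have e2 : i + 1 + k - (i + 1) = k := by omega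
      have e3 : n + (i + 1 + k) - i = n + k + 1 := by omega
      have e4 : i + 1 + k - i = k + 1 := by omega
      rw [e1, e2, e3, e4, Nat.choose_succ_succ]
      exact_mod_cast Nat.le_add_right _ _
    refine squeeze_zero (fun n => by positivity) (fun n => ?_) h1
    gcongr
    exact_mod_cast key n

theorem hilbert_coeff_one_le {d : ℕ} (hd : 1 ≤ d) {L : ℕ → ℕ} {e : ℕ → ℤ} {E w N n₀ : ℕ}
    (h1 : ∀ n ≥ n₀, E * (n + d).choose d ≤ L n + N * (n + d - 1).choose (d - 1))
    (h2 : ∀ n ≥ n₀, L n ≤ E * (n + d).choose d + w * (n + d - 1).choose (d - 1))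
    (h : ∀ n ≥ n₀, (L n : ℤ) = ∑ i ∈ Finset.range (d + 1),
      (-1) ^ i * e i * ((n + d - i).choose (d - i) : ℤ)) :
    e 1 ≤ N := by
  let a : ℕ → ℕ → ℝ := fun i n => ((n + d - i).choose (d - i) : ℝ)
  have ha : ∀ i ≤ d, ∀ n, 0 < a i n := by
    intro i hi n
    have : 0 < (n + d - i).choose (d - i) := Nat.choose_pos (by omega)
    simp only [a]
    exact_mod_cast this
  have hL : ∀ n ≥ n₀, (L n : ℝ) = ∑ i ∈ Finset.range (d + 1), (-1) ^ i * (e i : ℝ) * a i n := by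
    intro n hn
    have := congrArg (Int.cast : ℤ → ℝ) (h n hn)
    push_cast at this
    exact this
  have h1' : ∀ n ≥ n₀, (E : ℝ) * a 0 n ≤ L n + N * a 1 n := by
    intro n hn
    have := h1 n hn
    simp only [a, Nat.sub_zero]
    exact_mod_cast this
  have h2' : ∀ n ≥ n₀, (L n : ℝ) ≤ E * a 0 n + w * a 1 n := by
    intro n hn
    have := h2 n hn
    simp only [a, Nat.sub_zero]
    exact_mod_cast this
  have lim : ∀ i ≤ d, ∀ j < i, Tendsto (fun n => a i n / a j n) atTop (𝓝 0) :=
    fun i hi j hj => tendsto_choose_div_choose_zero hj hi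
  have lim0 : Tendsto (fun n => (L n : ℝ) / a 0 n) atTop (𝓝 (e 0 : ℝ)) := by
    have : Tendsto (fun n => (e 0 : ℝ) + ∑ i ∈ Finset.range d,
        (-1) ^ (i + 1) * (e (i + 1) : ℝ) * (a (i + 1) n / a 0 n)) atTop
        (𝓝 ((e 0 : ℝ) + ∑ i ∈ Finset.range d, (-1) ^ (i + 1) * (e (i + 1) : ℝ) * 0)) := by
      refine tendsto_const_nhds.add (tendsto_finsetSum _ fun i hi => ?_)
      exact (lim _ (by simpa using hi) _ (by omega)).const_mul _
    simp only [mul_zero, Finset.sum_const_zero, add_zero] at this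
    refine this.congr' ?_
    filter_upwards [eventually_ge_atTop n₀] with n hn
    rw [hL n hn, Finset.sum_range_succ', add_div, Finset.sum_div, add_comm]
    have := (ha 0 (by omega) n).ne'
    congr 1
    · exact Finset.sum_congr rfl fun i _ => by ring
    · field_simp
  have e0 : (e 0 : ℝ) = E := by
    apply le_antisymm
    · have l2 : Tendsto (fun n => (E : ℝ) + w * (a 1 n / a 0 n)) atTop (𝓝 (E + w * 0)) :=
        tendsto_const_nhds.add ((lim 1 hd 0 (by omega)).const_mul _)
      rw [mul_zero, add_zero] at l2
      refine le_of_tendsto_of_tendsto lim0 l2 ?_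
      filter_upwards [eventually_ge_atTop n₀] with n hn
      have := ha 0 (by omega) n
      rw [div_le_iff₀ this]
      have e : ((E : ℝ) + w * (a 1 n / a 0 n)) * a 0 n = E * a 0 n + w * a 1 n := by field_simp
      rw [e]; exact h2' n hn
    · have l2 : Tendsto (fun n => (E : ℝ) - N * (a 1 n / a 0 n)) atTop (𝓝 (E - N * 0)) :=
        tendsto_const_nhds.sub ((lim 1 hd 0 (by omega)).const_mul _)
      rw [mul_zero, sub_zero] at l2
      refine le_of_tendsto_of_tendsto l2 lim0 ?_
      filter_upwards [eventually_ge_atTop n₀] with n hn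
      have := ha 0 (by omega) n
      rw [le_div_iff₀ this]
      have e : ((E : ℝ) - N * (a 1 n / a 0 n)) * a 0 n = E * a 0 n - N * a 1 n := by field_simp
      rw [e]; linarith [h1' n hn]
  obtain ⟨d, rfl⟩ : ∃ k, d = k + 1 := ⟨d - 1, by omega⟩
  have lim1 : Tendsto (fun n => (-(e 1 : ℝ)) + ∑ i ∈ Finset.range d,
        (-1) ^ (i + 2) * (e (i + 2) : ℝ) * (a (i + 2) n / a 1 n)) atTop
        (𝓝 (-(e 1 : ℝ) + ∑ i ∈ Finset.range d, (-1) ^ (i + 2) * (e (i + 2) : ℝ) * 0)) := by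
    refine tendsto_const_nhds.add (tendsto_finsetSum _ fun i hi => ?_)
    exact (lim _ (by simpa using hi) _ (by omega)).const_mul _
  simp only [mul_zero, Finset.sum_const_zero, add_zero] at lim1
  have : (-(N : ℝ)) ≤ -(e 1 : ℝ) := by
    refine ge_of_tendsto lim1 ?_
    filter_upwards [eventually_ge_atTop n₀] with n hn
    have h3 := h1' n hn
    have h4 := ha 1 hd n
    rw [hL n hn, Finset.sum_range_succ', Finset.sum_range_succ', e0] at h3
    simp only [pow_zero, zero_add, pow_one, one_mul] at h3
    have e : ((-(e 1 : ℝ)) + ∑ i ∈ Finset.range d,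
        (-1) ^ (i + 2) * (e (i + 2) : ℝ) * (a (i + 2) n / a 1 n)) * a 1 n =
        -(e 1 : ℝ) * a 1 n + ∑ i ∈ Finset.range d,
        (-1) ^ (i + 2) * (e (i + 2) : ℝ) * a (i + 2) n := by
      rw [add_mul, Finset.sum_mul]
      congr 1
      exact Finset.sum_congr rfl fun i _ => by field_simp
    refine le_of_mul_le_mul_right ?_ h4
    rw [e]
    simp only [add_assoc, Nat.reduceAdd] at h3 ⊢
    linarith
  have : (e 1 : ℝ) ≤ N := by linarith
  exact_mod_cast this

end Asymptotics

section Systems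

variable {R : Type*} [CommRing R]

/-- The ideal generated by the first `i` terms of a sequence. -/
def headIdeal (x : ℕ → R) (i : ℕ) : Ideal R := Ideal.span (x '' Set.Iio i)

/-- The ideal generated by the terms of a sequence with index in `[l, d)`. -/
def tailIdeal (x : ℕ → R) (l d : ℕ) : Ideal R := Ideal.span (x '' Set.Ico l d)

/-- The ideal of elements multiplying `x i` into the ideal of the previous terms. -/
def headColon (x : ℕ → R) (i : ℕ) : Ideal R := (headIdeal x i).colon {x i}

theorem mem_headColon {x : ℕ → R} {i : ℕ} {c : R} :
    c ∈ headColon x i ↔ x i * c ∈ headIdeal x i := by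
  rw [headColon, Submodule.mem_colon_singleton, smul_eq_mul, mul_comm]

theorem headIdeal_zero (x : ℕ → R) : headIdeal x 0 = ⊥ := by
  simp [headIdeal]

theorem headIdeal_succ (x : ℕ → R) (i : ℕ) :
    headIdeal x (i + 1) = headIdeal x i ⊔ Ideal.span {x i} := by
  rw [headIdeal, headIdeal, ← Ideal.span_union, ← Set.image_singleton, ← Set.image_union]
  congr 2
  ext j
  simp only [Set.mem_Iio, Set.union_singleton, Set.mem_insert_iff]
  omega

theorem headIdeal_mono (x : ℕ → R) : Monotone (headIdeal x) := fun _ _ h =>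
  Ideal.span_mono (Set.image_mono (Set.Iio_subset_Iio h))

theorem mem_headIdeal (x : ℕ → R) {i j : ℕ} (h : j < i) : x j ∈ headIdeal x i :=
  Ideal.subset_span ⟨j, h, rfl⟩

theorem headIdeal_le_headColon (x : ℕ → R) (i : ℕ) : headIdeal x i ≤ headColon x i :=
  fun _ hc => mem_headColon.2 (Ideal.mul_mem_left _ _ hc)

theorem headIdeal_congr {x y : ℕ → R} {i : ℕ} (h : ∀ j < i, x j = y j) :
    headIdeal x i = headIdeal y i := by
  unfold headIdeal
  congr 1
  exact Set.image_congr fun j hj => h j hj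

theorem tailIdeal_self (x : ℕ → R) (d : ℕ) : tailIdeal x d d = ⊥ := by
  simp [tailIdeal]

theorem tailIdeal_eq (x : ℕ → R) {l d : ℕ} (h : l < d) :
    tailIdeal x l d = tailIdeal x (l + 1) d ⊔ Ideal.span {x l} := by
  rw [tailIdeal, tailIdeal, ← Ideal.span_union, ← Set.image_singleton, ← Set.image_union]
  congr 2
  ext j
  simp only [Set.mem_Ico, Set.union_singleton, Set.mem_insert_iff]
  omega

theorem mem_tailIdeal (x : ℕ → R) {l j d : ℕ} (h : l ≤ j) (h' : j < d) : x j ∈ tailIdeal x l d :=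
  Ideal.subset_span ⟨j, ⟨h, h'⟩, rfl⟩

theorem exists_of_mem_sup_span_singleton {J : Ideal R} {a z : R} (h : z ∈ J ⊔ Ideal.span {a}) :
    ∃ g, z - a * g ∈ J := by
  obtain ⟨w, hw, v, hv, rfl⟩ := Submodule.mem_sup.1 h
  obtain ⟨g, rfl⟩ := Ideal.mem_span_singleton'.1 hv
  exact ⟨g, by simpa [mul_comm] using hw⟩

theorem exists_of_mem_headIdeal_succ_mul {x : ℕ → R} {i : ℕ} {K : Ideal R} {z : R}
    (h : z ∈ headIdeal x (i + 1) * K) : ∃ v ∈ K, z - x i * v ∈ headIdeal x i * K := by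
  rw [headIdeal_succ, Ideal.sup_mul] at h
  obtain ⟨w, hw, v, hv, rfl⟩ := Submodule.mem_sup.1 h
  obtain ⟨g, hg, rfl⟩ := Ideal.mem_span_singleton_mul.1 hv
  exact ⟨g, hg, by simpa using hw⟩

/-- If each colon ideal of the sequence meets the total ideal only in the obvious elements, the
same intersection formula holds for all powers of the total ideal. -/
theorem headIdeal_inf_pow_le {x : ℕ → R} {d : ℕ}
    (hx : ∀ i < d, headColon x i ⊓ headIdeal x d ≤ headIdeal x i) (n : ℕ) :
    ∀ i ≤ d, headIdeal x i ⊓ headIdeal x d ^ (n + 1) ≤ headIdeal x i * headIdeal x d ^ n := by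
  induction n with
  | zero => intro i _; simp
  | succ n ih =>
    intro i hi
    induction hi using Nat.decreasingInduction with
    | self => rw [pow_succ' _ (n + 1)]; exact inf_le_right
    | of_succ i hi ihi =>
      rintro z ⟨hz1, hz2⟩
      obtain ⟨v, hv, hw⟩ := exists_of_mem_headIdeal_succ_mul
        (ihi ⟨headIdeal_mono x (Nat.le_succ i) hz1, hz2⟩)
      have hxv : x i * v ∈ headIdeal x i := by
        have := sub_mem hz1 (Ideal.mul_le_left hw)
        simpa using this
      have hv1 : v ∈ headIdeal x i :=
        hx i hi ⟨mem_headColon.2 hxv, Ideal.pow_le_self (Nat.succ_ne_zero n) hv⟩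
      have hv2 := ih i hi.le ⟨hv1, hv⟩
      have hv3 : x i * v ∈ headIdeal x i * headIdeal x d ^ (n + 1) := by
        rw [pow_succ, ← mul_assoc, mul_comm (x i)]
        exact Ideal.mul_mem_mul hv2 (mem_headIdeal x hi)
      have := add_mem hw hv3
      simpa using this

theorem pow_sup_headColon_colon_le {x : ℕ → R} {d : ℕ}
    (hx : ∀ i < d, headColon x i ⊓ headIdeal x d ≤ headIdeal x i) (n : ℕ) {i : ℕ} (hi : i < d) :
    (headIdeal x d ^ (n + 1) ⊔ headColon x i).colon {x i} ≤ headIdeal x d ^ n ⊔ headColon x i := by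
  intro z hz
  rw [Submodule.mem_colon_singleton, smul_eq_mul] at hz
  obtain ⟨w, hw, v, hv, hwv⟩ := Submodule.mem_sup.1 hz
  have hv1 : v ∈ headIdeal x d := by
    have : v = z * x i - w := by rw [← hwv]; ring
    rw [this]
    exact sub_mem (Ideal.mul_mem_left _ _ (mem_headIdeal x hi))
      (Ideal.pow_le_self (Nat.succ_ne_zero n) hw)
  have hv2 := hx i hi ⟨hv, hv1⟩
  have hw1 : w ∈ headIdeal x (i + 1) := by
    have : w = z * x i - v := by rw [← hwv]; ring
    rw [this]
    exact sub_mem (Ideal.mul_mem_left _ _ (mem_headIdeal x (Nat.lt_add_one i)))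
      (headIdeal_mono x (Nat.le_succ i) hv2)
  obtain ⟨g, hg, hg'⟩ := exists_of_mem_headIdeal_succ_mul
    (headIdeal_inf_pow_le hx n (i + 1) hi ⟨hw1, hw⟩)
  have : z - g ∈ headColon x i := by
    rw [mem_headColon]
    have e : x i * (z - g) = (w - x i * g) + v := by rw [mul_sub, mul_comm (x i) z, ← hwv]; ring
    rw [e]
    exact add_mem (Ideal.mul_le_left hg') hv2
  have e : z = g + (z - g) := by ring
  rw [e]
  exact Submodule.add_mem_sup hg this

variable [IsLocalRing R]

/-- A sequence in the maximal ideal whose terms lie in cubes of ideals that kill the colon ideals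
of the systems `u` completing the later terms. -/
structure IsKillingSystem (x : ℕ → R) (d : ℕ) (b : ℕ → Ideal R) : Prop where
  mem_maximalIdeal : ∀ j < d, x j ∈ maximalIdeal R
  mem_pow : ∀ l < d, x l ∈ b l ^ 3
  kill : ∀ l < d, ∀ u : ℕ → R, (∀ j ≤ l, u j ∈ maximalIdeal R) →
    (∀ j < d, x j ^ 2 ∈ headIdeal u (l + 1) ⊔ tailIdeal x (l + 1) d) → ∀ i ≤ l, ∀ c,
    u i * c ∈ headIdeal u i ⊔ tailIdeal x (l + 1) d → ∀ β ∈ b l,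
    β * c ∈ headIdeal u i ⊔ tailIdeal x (l + 1) d

namespace IsKillingSystem

variable {x : ℕ → R} {d : ℕ} {b : ℕ → Ideal R}

theorem self_mem (h : IsKillingSystem x d b) {l : ℕ} (hl : l < d) : x l ∈ b l :=
  Ideal.pow_le_self three_ne_zero (h.mem_pow l hl)

theorem mul_mem_of_sq_mul_mem (h : IsKillingSystem x d b) {i j : ℕ} (hij : i ≤ j) (hj : j < d)
    {c : R} (hc : x i ^ 2 * c ∈ headIdeal x i) : x j * c ∈ headIdeal x i := by
  have hi : i < d := hij.trans_lt hj
  let u : ℕ → R := Function.update x i (x i ^ 2)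
  have hui : u i = x i ^ 2 := Function.update_self ..
  have hune : ∀ k, k ≠ i → u k = x k := fun k hk => Function.update_of_ne hk ..
  have hu_mem : ∀ k < d, u k ∈ maximalIdeal R := by
    intro k hk
    by_cases hki : k = i
    · rw [hki, hui]
      exact Ideal.pow_mem_of_mem _ (h.mem_maximalIdeal i hi) _ two_pos
    · rw [hune k hki]; exact h.mem_maximalIdeal k hk
  have hu_head : headIdeal u i = headIdeal x i :=
    headIdeal_congr fun k hk => hune k (Nat.ne_of_lt hk)
  have hu_sq : ∀ l, i ≤ l → ∀ k < d, x k ^ 2 ∈ headIdeal u (l + 1) ⊔ tailIdeal x (l + 1) d := by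
    intro l hl k hk
    by_cases hkl : k < l + 1
    · refine Submodule.mem_sup_left ?_
      have := mem_headIdeal u hkl
      by_cases hki : k = i
      · rw [hki, hui] at this
        rwa [hki]
      · rw [hune k hki] at this
        exact Ideal.pow_mem_of_mem _ this _ two_pos
    · exact Submodule.mem_sup_right
        (Ideal.pow_mem_of_mem _ (mem_tailIdeal x (by omega) hk) _ two_pos)
  have key : ∀ l, j + 1 ≤ l → l ≤ d → x j * c ∈ headIdeal x i ⊔ tailIdeal x l d := by
    intro l hjl
    induction l, hjl using Nat.le_induction with
    | base =>
      intro _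
      rw [← hu_head]
      refine h.kill j hj u (fun k hk => hu_mem k (by omega)) (hu_sq j hij) i hij c ?_ (x j)
        (h.self_mem hj)
      rw [hui, hu_head]
      exact Submodule.mem_sup_left hc
    | succ l hjl ih =>
      intro hl
      have h1 := ih (by omega)
      rw [tailIdeal_eq x (by omega), ← sup_assoc] at h1
      obtain ⟨g, hg⟩ := exists_of_mem_sup_span_singleton h1
      have h2 : x l * (x l * g) ∈ headIdeal x i ⊔ tailIdeal x (l + 1) d := by
        rw [← hu_head]
        refine h.kill l (by omega) u (fun k hk => hu_mem k (by omega)) (hu_sq l (by omega)) i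
          (by omega) (x l * g) ?_ (x l) (h.self_mem (by omega))
        rw [hui, hu_head]
        have e : x i ^ 2 * (x l * g) = x j * (x i ^ 2 * c) - x i ^ 2 * (x j * c - x l * g) := by
          ring
        rw [e]
        exact sub_mem (Submodule.mem_sup_left (Ideal.mul_mem_left _ _ hc))
          (Ideal.mul_mem_left _ _ hg)
      let v : ℕ → R := Function.update (Function.update x l (x i)) i (x l ^ 2)
      have hil : l ≠ i := by omega
      have hvi : v i = x l ^ 2 := Function.update_self ..
      have hvl : v l = x i := by
        simp only [v]
        rw [Function.update_of_ne hil, Function.update_self]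
      have hvne : ∀ k, k ≠ i → k ≠ l → v k = x k := fun k hk hk' => by
        simp only [v]
        rw [Function.update_of_ne hk, Function.update_of_ne hk']
      have hv_head : headIdeal v i = headIdeal x i :=
        headIdeal_congr fun k hk => hvne k (by omega) (by omega)
      have h3 : x l * g ∈ headIdeal x i ⊔ tailIdeal x (l + 1) d := by
        rw [← hv_head]
        refine h.kill l (by omega) v ?_ ?_ i (by omega) g ?_ (x l) (h.self_mem (by omega))
        · intro k hk
          by_cases hki : k = i
          · rw [hki, hvi]
            exact Ideal.pow_mem_of_mem _ (h.mem_maximalIdeal l (by omega)) _ two_pos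
          · by_cases hkl : k = l
            · rw [hkl, hvl]; exact h.mem_maximalIdeal i hi
            · rw [hvne k hki hkl]; exact h.mem_maximalIdeal k (by omega)
        · intro k hk
          by_cases hkl : k < l + 1
          · refine Submodule.mem_sup_left ?_
            by_cases hki : k = i
            · have := mem_headIdeal v (Nat.lt_add_one l)
              rw [hvl] at this
              rw [hki]
              exact Ideal.pow_mem_of_mem _ this _ two_pos
            · by_cases hkl' : k = l
              · have := mem_headIdeal v (show i < l + 1 by omega)
                rw [hvi] at this
                rwa [hkl']
              · have := mem_headIdeal v hkl
                rw [hvne k hki hkl'] at this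
                exact Ideal.pow_mem_of_mem _ this _ two_pos
          · exact Submodule.mem_sup_right
              (Ideal.pow_mem_of_mem _ (mem_tailIdeal x (by omega) hk) _ two_pos)
        · rw [hvi, hv_head, pow_two, mul_assoc]
          exact h2
      have := add_mem hg h3
      simpa using this
  have := key d (by omega) le_rfl
  rwa [tailIdeal_self, sup_bot_eq] at this

theorem mul_mem_of_mem_headColon (h : IsKillingSystem x d b) {i j : ℕ} (hij : i ≤ j) (hj : j < d)
    {c : R} (hc : c ∈ headColon x i) : x j * c ∈ headIdeal x i := by
  refine h.mul_mem_of_sq_mul_mem hij hj ?_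
  rw [pow_two, mul_assoc]
  exact Ideal.mul_mem_left _ _ (mem_headColon.1 hc)

theorem headColon_le_succ (h : IsKillingSystem x d b) {i : ℕ} (hi : i + 1 < d) :
    headColon x i ≤ headColon x (i + 1) := fun _ hc =>
  mem_headColon.2 (headIdeal_mono x (Nat.le_succ i)
    (h.mul_mem_of_mem_headColon (Nat.le_succ i) hi hc))

theorem headColon_inf_le (h : IsKillingSystem x d b) (i : ℕ) (_hi : i < d) :
    headColon x i ⊓ headIdeal x d ≤ headIdeal x i := by
  suffices ∀ j, i ≤ j → j ≤ d → headColon x i ⊓ headIdeal x j ≤ headIdeal x i from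
    this d (by omega) le_rfl
  intro j hij
  induction j, hij using Nat.le_induction with
  | base => intro _; exact inf_le_right
  | succ j hij ih =>
    rintro hj z ⟨hz1, hz2⟩
    refine ih (by omega) ⟨hz1, ?_⟩
    rw [headIdeal_succ] at hz2
    obtain ⟨g, hg⟩ := exists_of_mem_sup_span_singleton hz2
    have h1 := h.mul_mem_of_mem_headColon hij hj hz1
    have h2 : x j ^ 2 * g ∈ headIdeal x j := by
      have e : x j ^ 2 * g = x j * z - x j * (z - x j * g) := by ring
      rw [e]
      exact sub_mem (headIdeal_mono x hij h1) (Ideal.mul_mem_left _ _ hg)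
    have h3 := h.mul_mem_of_sq_mul_mem le_rfl hj h2
    have := add_mem hg h3
    simpa using this

theorem colon_maximalIdeal_le {D : ℕ} (h : IsKillingSystem x (D + 1) b) :
    (headIdeal x (D + 1) ⊔ headColon x D).colon (maximalIdeal R : Set R) ≤
      (headIdeal x (D + 1)).colon (maximalIdeal R : Set R) ⊔ headColon x D := by
  set X := headIdeal x D with hX
  set V := headColon x D with hV
  have hbV : ∀ β ∈ b D, ∀ v ∈ V, β * v ∈ X := by
    intro β hβ v hv
    have := h.kill D (Nat.lt_add_one D) x (fun j hj => h.mem_maximalIdeal j (by omega))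
      (fun j hj => Submodule.mem_sup_left (Ideal.pow_mem_of_mem _ (mem_headIdeal x hj) _ two_pos))
      D le_rfl v (Submodule.mem_sup_left (mem_headColon.1 hv)) β hβ
    rwa [tailIdeal_self, sup_bot_eq] at this
  have hXV : X ≤ V := headIdeal_le_headColon x D
  by_cases hb : b D = ⊤
  · have hVX : V ≤ X := fun v hv => by
      have := hbV 1 (by rw [hb]; trivial) v hv
      rwa [one_mul] at this
    have : headIdeal x (D + 1) ⊔ V = headIdeal x (D + 1) :=
      sup_eq_left.2 (hVX.trans (headIdeal_mono x (Nat.le_succ D)))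
    rw [this]
    exact le_sup_left
  have hbm : b D ≤ maximalIdeal R := le_maximalIdeal hb
  have hsplit : headIdeal x (D + 1) ⊔ V = V ⊔ Ideal.span {x D} := by
    rw [headIdeal_succ, sup_right_comm, sup_eq_right.2 hXV]
  intro c hc
  have hc' : ∀ y ∈ maximalIdeal R, ∃ f, y * c - x D * f ∈ V := by
    intro y hy
    have := Submodule.mem_colon.1 hc y hy
    rw [hsplit] at this
    obtain ⟨f, hf⟩ := exists_of_mem_sup_span_singleton this
    exact ⟨f, by simpa [mul_comm] using hf⟩
  have claim : ∀ w ∈ b D * b D, ∃ c', x D * c' - w * c ∈ X ∧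
      ∀ y ∈ maximalIdeal R, ∀ f, y * c - x D * f ∈ V → y * c' - w * f ∈ X := by
    intro w hw
    induction hw using Submodule.mul_induction_on' with
    | mem_mul_mem p hp r hr =>
      obtain ⟨k, hk⟩ := hc' r (hbm hr)
      refine ⟨p * k, ?_, ?_⟩
      · have := neg_mem (hbV p hp _ hk)
        have e : x D * (p * k) - p * r * c = -(p * (r * c - x D * k)) := by ring
        rwa [e]
      · intro y hy f hf
        have h1 : x D * (y * k - r * f) ∈ V := by
          have e : x D * (y * k - r * f) = r * (y * c - x D * f) - y * (r * c - x D * k) := by ring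
          rw [e]
          exact sub_mem (Ideal.mul_mem_left _ _ hf) (Ideal.mul_mem_left _ _ hk)
        have h2 : y * k - r * f ∈ V := by
          rw [hV, mem_headColon]
          refine h.mul_mem_of_sq_mul_mem le_rfl (Nat.lt_add_one D) ?_
          rw [pow_two, mul_assoc]
          exact mem_headColon.1 h1
        have := hbV p hp _ h2
        have e : y * (p * k) - p * r * f = p * (y * k - r * f) := by ring
        rwa [e]
    | add w₁ _ w₂ _ h₁ h₂ =>
      obtain ⟨c₁, h₁, h₁'⟩ := h₁
      obtain ⟨c₂, h₂, h₂'⟩ := h₂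
      refine ⟨c₁ + c₂, ?_, ?_⟩
      · have e : x D * (c₁ + c₂) - (w₁ + w₂) * c = (x D * c₁ - w₁ * c) + (x D * c₂ - w₂ * c) := by
          ring
        rw [e]; exact add_mem h₁ h₂
      · intro y hy f hf
        have e : y * (c₁ + c₂) - (w₁ + w₂) * f = (y * c₁ - w₁ * f) + (y * c₂ - w₂ * f) := by
          ring
        rw [e]; exact add_mem (h₁' y hy f hf) (h₂' y hy f hf)
  have hxD : x D ∈ b D * b D := by
    rw [← pow_two]
    exact Ideal.pow_le_pow_right (by omega) (h.mem_pow D (Nat.lt_add_one D))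
  obtain ⟨c', h1, h2⟩ := claim _ hxD
  have e : c = c' + (c - c') := by ring
  rw [e]
  refine Submodule.add_mem_sup ?_ ?_
  · refine Submodule.mem_colon.2 fun y hy => ?_
    obtain ⟨f, hf⟩ := hc' y hy
    have h3 := h2 y hy f hf
    have e : c' • y = (y * c' - x D * f) + x D * f := by rw [smul_eq_mul]; ring
    rw [e]
    exact add_mem (headIdeal_mono x (Nat.le_succ D) h3)
      (Ideal.mul_mem_right _ _ (mem_headIdeal x (Nat.lt_add_one D)))
  · rw [hV, mem_headColon]
    have e : x D * (c - c') = -(x D * c' - x D * c) := by ring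
    rw [e]
    exact neg_mem h1

end IsKillingSystem

end Systems

section PascalBounds

theorem mul_choose_le_of_pascal {G : ℕ → ℕ → ℕ∞} {E N : ℕ∞}
    (h0 : ∀ n, (n + 1 : ℕ) * E ≤ G n 0 + N)
    (hz : ∀ k, G 0 k ≤ G 0 (k + 1))
    (hs : ∀ n k, G n (k + 1) + G (n + 1) k ≤ G (n + 1) (k + 1)) (k n : ℕ) :
    ((n + k + 1).choose (k + 1) : ℕ) * E ≤ G n k + ((n + k).choose k : ℕ) * N := by
  induction k generalizing n with
  | zero => simpa using h0 n
  | succ k ihk =>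
    induction n with
    | zero =>
      have := ihk 0
      simp only [zero_add, Nat.choose_self, Nat.cast_one, one_mul] at this ⊢
      exact this.trans (by gcongr; exact hz k)
    | succ n ihn =>
      have h1 := ihk (n + 1)
      have e1 : n + 1 + (k + 1) + 1 = (n + (k + 1) + 1) + 1 := by ring
      have e2 : n + 1 + (k + 1) = (n + (k + 1)) + 1 := by ring
      have e3 : n + 1 + k + 1 = n + (k + 1) + 1 := by ring
      have e4 : n + 1 + k = n + (k + 1) := by ring
      rw [e3, e4] at h1
      have c1 : ((n + 1 + (k + 1) + 1).choose (k + 1 + 1) : ℕ∞) =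
          (n + (k + 1) + 1).choose (k + 1 + 1) + (n + (k + 1) + 1).choose (k + 1) := by
        rw [e1, Nat.choose_succ_succ', Nat.cast_add, add_comm]
      have c2 : ((n + 1 + (k + 1)).choose (k + 1) : ℕ∞) =
          (n + (k + 1)).choose (k + 1) + (n + (k + 1)).choose k := by
        rw [e2, Nat.choose_succ_succ', Nat.cast_add, add_comm]
      rw [c1, c2]
      calc _ = ((n + (k + 1) + 1).choose (k + 1 + 1) : ℕ∞) * E
            + ((n + (k + 1) + 1).choose (k + 1) : ℕ∞) * E := by ring
        _ ≤ (G n (k + 1) + ((n + (k + 1)).choose (k + 1) : ℕ∞) * N) +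
            (G (n + 1) k + ((n + (k + 1)).choose k : ℕ∞) * N) := add_le_add ihn h1
        _ = (G n (k + 1) + G (n + 1) k) + (((n + (k + 1)).choose (k + 1) : ℕ∞)
            + ((n + (k + 1)).choose k : ℕ∞)) * N := by ring
        _ ≤ _ := by gcongr; exact hs n k

theorem le_mul_choose_of_pascal {F : ℕ → ℕ → ℕ∞} {s w : ℕ∞}
    (h0 : ∀ n, F n 0 ≤ (n + 1 : ℕ) * s + w)
    (hz : ∀ k, F 0 (k + 1) ≤ F 0 k)
    (hs : ∀ n k, F (n + 1) (k + 1) ≤ F n (k + 1) + F (n + 1) k) (k n : ℕ) :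
    F n k ≤ ((n + k + 1).choose (k + 1) : ℕ) * s + ((n + k).choose k : ℕ) * w := by
  induction k generalizing n with
  | zero => simpa using h0 n
  | succ k ihk =>
    induction n with
    | zero =>
      have := ihk 0
      simp only [zero_add, Nat.choose_self, Nat.cast_one, one_mul] at this ⊢
      exact (hz k).trans this
    | succ n ihn =>
      have h1 := ihk (n + 1)
      have e1 : n + 1 + (k + 1) + 1 = (n + (k + 1) + 1) + 1 := by ring
      have e2 : n + 1 + (k + 1) = (n + (k + 1)) + 1 := by ring
      have e3 : n + 1 + k + 1 = n + (k + 1) + 1 := by ring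
      have e4 : n + 1 + k = n + (k + 1) := by ring
      rw [e3, e4] at h1
      have c1 : ((n + 1 + (k + 1) + 1).choose (k + 1 + 1) : ℕ∞) =
          (n + (k + 1) + 1).choose (k + 1 + 1) + (n + (k + 1) + 1).choose (k + 1) := by
        rw [e1, Nat.choose_succ_succ', Nat.cast_add, add_comm]
      have c2 : ((n + 1 + (k + 1)).choose (k + 1) : ℕ∞) =
          (n + (k + 1)).choose (k + 1) + (n + (k + 1)).choose k := by
        rw [e2, Nat.choose_succ_succ', Nat.cast_add, add_comm]
      rw [c1, c2]
      calc _ ≤ F n (k + 1) + F (n + 1) k := hs n k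
        _ ≤ (((n + (k + 1) + 1).choose (k + 1 + 1) : ℕ∞) * s +
              ((n + (k + 1)).choose (k + 1) : ℕ∞) * w) +
            (((n + (k + 1) + 1).choose (k + 1) : ℕ∞) * s +
              ((n + (k + 1)).choose k : ℕ∞) * w) := add_le_add ihn h1
        _ = _ := by ring

end PascalBounds

section ColengthBounds

variable {R : Type*} [CommRing R]

theorem colen_sup_span_pow_le {Y : Ideal R} {z : R} {M : ℕ} {s w : ℕ∞}
    (hs : colen (Y.colon {z ^ M} ⊔ Ideal.span {z}) ≤ s)
    (hw : colen (Y ⊔ Ideal.span {z ^ M}) ≤ w) (m : ℕ) :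
    colen (Y ⊔ Ideal.span {z ^ m}) ≤ m * s + w := by
  rcases le_total m M with hm | hm
  · refine ((colen_anti ?_).trans hw).trans le_add_self
    exact sup_le_sup_left (Ideal.span_singleton_le_span_singleton.2 (pow_dvd_pow z hm)) _
  · induction m, hm using Nat.le_induction with
    | base => exact hw.trans le_add_self
    | succ m hm ih =>
      rw [colen_eq_colon_add _ (z ^ m)]
      have h1 : colen ((Y ⊔ Ideal.span {z ^ (m + 1)}).colon {z ^ m}) ≤ s := by
        refine (colen_anti (sup_le ?_ ?_)).trans hs
        · intro c hc
          rw [Submodule.mem_colon_singleton, smul_eq_mul] at hc ⊢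
          refine Submodule.mem_sup_left ?_
          obtain ⟨k, rfl⟩ := Nat.exists_eq_add_of_le hm
          rw [pow_add, ← mul_assoc]
          exact Ideal.mul_mem_right _ _ hc
        · rw [Ideal.span_singleton_le_iff_mem, Submodule.mem_colon_singleton, smul_eq_mul,
            ← pow_succ']
          exact Submodule.mem_sup_right (Ideal.mem_span_singleton_self _)
      have h2 : colen (Y ⊔ Ideal.span {z ^ (m + 1)} ⊔ Ideal.span {z ^ m}) ≤ m * s + w :=
        (colen_anti (sup_le_sup_right le_sup_left _)).trans ih
      refine (add_le_add h1 h2).trans (le_of_eq ?_)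
      push_cast
      ring

theorem colen_pow_le {y : ℕ → R} {t : ℕ} {z : R} {M : ℕ} {s w : ℕ∞}
    (hs : colen ((headIdeal y t).colon {z ^ M} ⊔ Ideal.span {z}) ≤ s)
    (hw : colen (headIdeal y t ⊔ Ideal.span {z ^ M}) ≤ w) (n : ℕ) :
    colen ((headIdeal y t ⊔ Ideal.span {z}) ^ (n + 1)) ≤
      ((n + t + 1).choose (t + 1) : ℕ) * s + ((n + t).choose t : ℕ) * w := by
  set J := headIdeal y t ⊔ Ideal.span {z} with hJ
  let F : ℕ → ℕ → ℕ∞ := fun n k => if k ≤ t then colen (J ^ (n + 1) ⊔ headIdeal y (t - k)) else 0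
  have hFt : F n t = colen (J ^ (n + 1)) := by simp [F, headIdeal_zero]
  have hmem : ∀ l < t, y l ∈ J := fun l hl => Submodule.mem_sup_left (mem_headIdeal y hl)
  have hstep : ∀ n k, k + 1 ≤ t → F n (k + 1) ≤
      colen (J ^ n ⊔ headIdeal y (t - (k + 1))) + F n k := by
    intro n k hk
    have hk' : k ≤ t := by omega
    simp only [F, hk, hk', if_true]
    rw [colen_eq_colon_add _ (y (t - (k + 1)))]
    refine add_le_add (colen_anti (sup_le ?_ ?_)) (colen_anti ?_)
    · intro c hc
      rw [Submodule.mem_colon_singleton, smul_eq_mul]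
      refine Submodule.mem_sup_left ?_
      rw [pow_succ]
      exact Ideal.mul_mem_mul hc (hmem _ (by omega))
    · exact le_sup_right.trans Ideal.le_colon
    · have e : t - k = t - (k + 1) + 1 := by omega
      rw [e, headIdeal_succ, ← sup_assoc]
  rw [← hFt]
  refine le_mul_choose_of_pascal ?_ ?_ ?_ t n
  · intro n
    simp only [F, Nat.zero_le, if_true, Nat.sub_zero]
    refine (colen_anti ?_).trans (colen_sup_span_pow_le hs hw (n + 1))
    refine sup_le le_sup_right ?_
    rw [Ideal.span_singleton_le_iff_mem]
    exact Submodule.mem_sup_left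
      (Ideal.pow_mem_pow (Submodule.mem_sup_right (Ideal.mem_span_singleton_self z)) _)
  · intro k
    by_cases hk : k + 1 ≤ t
    · have := hstep 0 k hk
      rwa [pow_zero, Ideal.one_eq_top, top_sup_eq, colen_top, zero_add] at this
    · simp [F, hk]
  · intro n k
    by_cases hk : k + 1 ≤ t
    · have := hstep (n + 1) k hk
      simpa only [F, hk, if_true] using this
    · simp [F, hk]

variable [IsLocalRing R]

theorem IsKillingSystem.mul_choose_le_colen_pow {x : ℕ → R} {D : ℕ} {b : ℕ → Ideal R}
    (h : IsKillingSystem x (D + 1) b) {I : Ideal R}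
    (hI : ∀ n, maximalIdeal R * I ^ (n + 1) ≤ headIdeal x (D + 1) ^ (n + 1)) {N : ℕ∞}
    (hN : colen (headIdeal x (D + 1) ⊔ headColon x D) ≤
      colen ((headIdeal x (D + 1) ⊔ headColon x D).colon (maximalIdeal R : Set R)) + N) (n : ℕ) :
    ((n + D + 1).choose (D + 1) : ℕ) * colen (headIdeal x (D + 1) ⊔ headColon x D) ≤
      colen (I ^ (n + 1)) + ((n + D).choose D : ℕ) * N := by
  set q := headIdeal x (D + 1) with hq
  set E := colen (q ⊔ headColon x D) with hE
  let K : ℕ → ℕ → Ideal R := fun n l =>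
    (q ^ (n + 1) ⊔ headColon x l).colon (maximalIdeal R : Set R)
  have hK : ∀ {n l c}, c ∈ K n l ↔ ∀ y ∈ maximalIdeal R, c * y ∈ q ^ (n + 1) ⊔ headColon x l :=
    Submodule.mem_colon
  have hS := fun n i hi => pow_sup_headColon_colon_le (x := x) h.headColon_inf_le n (i := i) hi
  have hcolon : ∀ n l, l ≤ D → (K (n + 1) l).colon {x l} ≤ K n l := by
    intro n l hl c hc
    rw [hK]
    intro y hy
    rw [Submodule.mem_colon_singleton, smul_eq_mul, hK] at hc
    refine hS (n + 1) l (by omega) ?_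
    rw [Submodule.mem_colon_singleton, smul_eq_mul, mul_right_comm]
    exact hc y hy
  have hsup : ∀ n l, l + 1 ≤ D → K n l ⊔ Ideal.span {x l} ≤ K n (l + 1) := by
    intro n l hl
    refine sup_le ?_ ?_
    · exact Submodule.colon_mono (sup_le_sup_left (h.headColon_le_succ (by omega)) _) le_rfl
    · rw [Ideal.span_singleton_le_iff_mem, hK]
      intro y _
      exact Submodule.mem_sup_right (headIdeal_le_headColon x (l + 1)
        (Ideal.mul_mem_right _ _ (mem_headIdeal x (Nat.lt_succ_self l))))
  have hbase : ∀ n, (n + 1 : ℕ) * E ≤ colen (K n D) + N := by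
    intro n
    induction n with
    | zero => simpa [K] using hN
    | succ n ih =>
      have h1 := colen_anti (hcolon n D le_rfl)
      have h2 : E ≤ colen (K (n + 1) D ⊔ Ideal.span {x D}) := by
        refine colen_anti (sup_le ?_ ?_)
        · intro c hc
          have h3 := hK.1 hc (x D) (h.mem_maximalIdeal D (Nat.lt_succ_self D))
          have h4 : q ^ (n + 1 + 1) ⊔ headColon x D ≤ headColon x D ⊔ Ideal.span {x D ^ 2} := by
            refine sup_le ?_ le_sup_left
            refine (Ideal.pow_le_pow_right (show 2 ≤ n + 1 + 1 by omega)).trans ?_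
            rw [hq, headIdeal_succ, pow_two, Ideal.sup_mul, Ideal.mul_sup (Ideal.span {x D})]
            refine sup_le (Ideal.mul_le_left.trans
              ((headIdeal_le_headColon x D).trans le_sup_left)) (sup_le (Ideal.mul_le_right.trans
              ((headIdeal_le_headColon x D).trans le_sup_left)) ?_)
            rw [Ideal.span_singleton_mul_span_singleton, ← pow_two]
            exact le_sup_right
          obtain ⟨g, hg⟩ := exists_of_mem_sup_span_singleton (h4 h3)
          have h5 : c - x D * g ∈ headColon x D := by
            rw [mem_headColon]
            refine h.mul_mem_of_sq_mul_mem le_rfl (Nat.lt_succ_self D) ?_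
            rw [mem_headColon] at hg
            have e : x D ^ 2 * (c - x D * g) = x D * (c * x D - x D ^ 2 * g) := by ring
            rw [e]; exact hg
          have e : c = x D * g + (c - x D * g) := by ring
          rw [e]
          exact Submodule.add_mem_sup
            (Ideal.mul_mem_right _ _ (mem_headIdeal x (Nat.lt_succ_self D))) h5
        · rw [Ideal.span_singleton_le_iff_mem]
          exact Submodule.mem_sup_left (mem_headIdeal x (Nat.lt_succ_self D))
      calc ((n + 1 + 1 : ℕ) : ℕ∞) * E = (n + 1 : ℕ) * E + E := by push_cast; ring
        _ ≤ colen (K n D) + N + colen (K (n + 1) D ⊔ Ideal.span {x D}) := add_le_add ih h2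
        _ = (colen (K n D) + colen (K (n + 1) D ⊔ Ideal.span {x D})) + N := by ring
        _ ≤ _ := by
          rw [colen_eq_colon_add (K (n + 1) D) (x D)]
          gcongr
  have hfin : K n 0 ≥ I ^ (n + 1) := by
    intro c hc
    rw [hK]
    intro y hy
    rw [mul_comm]
    exact Submodule.mem_sup_left (hI n (Ideal.mul_mem_mul hy hc))
  refine le_trans ?_ (add_le_add_left (colen_anti hfin) _)
  let G : ℕ → ℕ → ℕ∞ := fun n k => if k ≤ D then colen (K n (D - k)) else ⊤
  have hG : G n D = colen (K n 0) := by simp [G]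
  rw [← hG]
  refine mul_choose_le_of_pascal ?_ ?_ ?_ D n
  · intro n
    simpa [G] using hbase n
  · intro k
    by_cases hk : k + 1 ≤ D
    · have hk' : k ≤ D := by omega
      simp only [G, hk, hk', if_true]
      refine colen_anti (le_sup_left.trans ((hsup 0 (D - (k + 1)) (by omega)).trans ?_))
      rw [show D - (k + 1) + 1 = D - k by omega]
    · simp [G, hk]
  · intro n k
    by_cases hk : k + 1 ≤ D
    · have hk' : k ≤ D := by omega
      simp only [G, hk, hk', if_true]
      rw [colen_eq_colon_add (K (n + 1) (D - (k + 1))) (x (D - (k + 1)))]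
      refine add_le_add (colen_anti (hcolon n _ (by omega))) (colen_anti ?_)
      have := hsup (n + 1) (D - (k + 1)) (by omega)
      rwa [show D - (k + 1) + 1 = D - k by omega] at this
    · simp [G, hk]

end ColengthBounds

section Dimension

variable {R : Type*} [CommRing R]

/-- The ring `R ⧸ J` has Krull dimension at least `n`. -/
def QuotDimGE (n : ℕ) (J : Ideal R) : Prop := (n : WithBot ℕ∞) ≤ ringKrullDim (R ⧸ J)

theorem natCast_le_of_succ_le_add_one {n : ℕ} {a : WithBot ℕ∞}
    (h : ((n + 1 : ℕ) : WithBot ℕ∞) ≤ a + 1) : (n : WithBot ℕ∞) ≤ a := by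
  induction a with
  | bot => simp at h
  | coe a =>
    norm_cast at h ⊢
    rw [Nat.cast_add, Nat.cast_one] at h
    exact (ENat.add_le_add_iff_right ENat.one_ne_top).1 h

theorem QuotDimGE.mono {n : ℕ} {J K : Ideal R} (hJK : J ≤ K) (h : QuotDimGE n K) :
    QuotDimGE n J :=
  h.trans (ringKrullDim_le_of_surjective _ (Ideal.Quotient.factor_surjective hJK))

theorem QuotDimGE.of_le {n n' : ℕ} (hn : n' ≤ n) {J : Ideal R} (h : QuotDimGE n J) :
    QuotDimGE n' J :=
  le_trans (by exact_mod_cast hn) h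

theorem QuotDimGE.ne_top {n : ℕ} {J : Ideal R} (h : QuotDimGE n J) : J ≠ ⊤ := by
  rintro rfl
  have : Subsingleton (R ⧸ (⊤ : Ideal R)) := Ideal.Quotient.subsingleton_iff.2 rfl
  unfold QuotDimGE at h
  rw [ringKrullDim_eq_bot_of_subsingleton] at h
  simp at h

theorem quotDimGE_bot {n : ℕ} : QuotDimGE n (⊥ : Ideal R) ↔ (n : WithBot ℕ∞) ≤ ringKrullDim R := by
  unfold QuotDimGE
  rw [ringKrullDim_eq_of_ringEquiv (RingEquiv.quotientBot R)]

theorem QuotDimGE.exists_prime {n : ℕ} {J : Ideal R} (h : QuotDimGE n J) :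
    ∃ P : Ideal R, P.IsPrime ∧ J ≤ P ∧ QuotDimGE n P := by
  unfold QuotDimGE at h
  rw [ringKrullDim_quotient, Order.le_krullDim_iff] at h
  obtain ⟨l, hl⟩ := h
  refine ⟨l.head.1.asIdeal, l.head.1.2, l.head.2, ?_⟩
  unfold QuotDimGE
  rw [ringKrullDim_quotient, Order.le_krullDim_iff]
  refine ⟨⟨l.length, fun i => ⟨(l i).1, ?_⟩, fun i => l.step i⟩, hl⟩
  exact l.head_le i

theorem QuotDimGE.succ_of_not_le {n : ℕ} {P K : Ideal R} [P.IsPrime] (hK : ¬ K ≤ P)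
    (h : QuotDimGE n (P ⊔ K)) : QuotDimGE (n + 1) P := by
  obtain ⟨r, hr, hrP⟩ := SetLike.not_le_iff_exists.1 hK
  have := ringKrullDim_succ_le_of_surjective (Ideal.Quotient.factor (le_sup_left : P ≤ P ⊔ K))
    (Ideal.Quotient.factor_surjective _) (r := Ideal.Quotient.mk P r)
    (mem_nonZeroDivisors_of_ne_zero (by rwa [Ne, Ideal.Quotient.eq_zero_iff_mem]))
    (by
      rw [Ideal.Quotient.factor_mk, Ideal.Quotient.eq_zero_iff_mem]
      exact Submodule.mem_sup_right hr)
  refine le_trans ?_ this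
  push_cast
  gcongr
  exact h

variable [IsLocalRing R] [IsNoetherianRing R]

theorem QuotDimGE.sup_span {n : ℕ} {J : Ideal R} {x : R} (hx : x ∈ maximalIdeal R)
    (h : QuotDimGE (n + 1) J) : QuotDimGE n (J ⊔ Ideal.span {x}) := by
  have hJ := h.ne_top
  have : Nontrivial (R ⧸ J) := Ideal.Quotient.nontrivial_iff.2 hJ
  have hloc : IsLocalRing (R ⧸ J) :=
    .of_surjective' (Ideal.Quotient.mk J) Ideal.Quotient.mk_surjective
  have h1 := ringKrullDim_le_ringKrullDim_quotient_add_card (R := R ⧸ J)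
    {Ideal.Quotient.mk J x} (by
      rw [Finset.coe_singleton, Set.singleton_subset_iff, SetLike.mem_coe,
        IsLocalRing.ringJacobson_eq_maximalIdeal]
      exact ((IsLocalRing.mem_maximalIdeal _).2 fun hu => by
        have hloc' : IsLocalHom (Ideal.Quotient.mk J) := .of_surjective _ Ideal.Quotient.mk_surjective
        exact (IsLocalRing.mem_maximalIdeal _).1 hx (isUnit_of_map_unit _ _ hu)))
  have h2 : ringKrullDim ((R ⧸ J) ⧸ Ideal.span ((({Ideal.Quotient.mk J x} : Finset (R ⧸ J))) : Set (R ⧸ J)))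
      = ringKrullDim (R ⧸ J ⊔ Ideal.span {x}) := by
    rw [← ringKrullDim_eq_of_ringEquiv (DoubleQuot.quotQuotEquivQuotSup J (Ideal.span {x})),
      Ideal.map_span, Set.image_singleton, Finset.coe_singleton]
  rw [h2, Finset.card_singleton, Nat.cast_one] at h1
  exact natCast_le_of_succ_le_add_one (h.trans h1)

theorem QuotDimGE.sup_headIdeal {n l : ℕ} {J : Ideal R} {u : ℕ → R}
    (hu : ∀ j < l, u j ∈ maximalIdeal R) (h : QuotDimGE (n + l) J) :
    QuotDimGE n (J ⊔ headIdeal u l) := by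
  induction l generalizing n with
  | zero => simpa [headIdeal_zero] using h
  | succ l ih =>
    rw [headIdeal_succ, ← sup_assoc]
    exact (ih (fun j hj => hu j (by omega)) (h.of_le (by omega))).sup_span (hu l (by omega))

theorem not_quotDimGE_of_pow_le {N : ℕ} {K : Ideal R} (h : maximalIdeal R ^ N ≤ K) :
    ¬ QuotDimGE 1 K := by
  intro h1
  have := (isArtinianRing_iff_isNoetherianRing_krullDimLE_zero.1
    ((isArtinianRing_quotient_iff h1.ne_top).2 ⟨N, h⟩)).2
  have h2 := h1.trans (Ring.krullDimLE_iff.1 this)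
  norm_cast at h2

theorem not_quotDimGE_headIdeal {N t : ℕ} {y : ℕ → R} (hy : ∀ j < t, y j ∈ maximalIdeal R)
    (h : maximalIdeal R ^ N ≤ headIdeal y t) {i : ℕ} (hi : i ≤ t) :
    ¬ QuotDimGE (t - i + 1) (headIdeal y i) := by
  induction hi using Nat.decreasingInduction with
  | self => simpa using not_quotDimGE_of_pow_le h
  | of_succ i hi ih =>
    intro h'
    apply ih
    rw [headIdeal_succ]
    exact (h'.of_le (by omega)).sup_span (hy i hi)

theorem quotDimGE_headIdeal {t : ℕ} {y : ℕ → R} (hy : ∀ j < t, y j ∈ maximalIdeal R)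
    (h : (t : WithBot ℕ∞) ≤ ringKrullDim R) {i : ℕ} (hi : i ≤ t) :
    QuotDimGE (t - i) (headIdeal y i) := by
  have := QuotDimGE.sup_headIdeal (n := t - i) (l := i) (J := ⊥) (u := y)
    (fun j hj => hy j (by omega)) ((quotDimGE_bot.2 h).of_le (by omega))
  simpa using this

end Dimension

section RegularLocal

variable {R : Type*} [CommRing R] [IsLocalRing R] [IsNoetherianRing R]

/-- If the maximal ideal is generated by at most `dim R` elements, the partial ideals are prime. -/
theorem isPrime_headIdeal {t : ℕ} {y : ℕ → R} (hm : maximalIdeal R = headIdeal y t)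
    (h : (t : WithBot ℕ∞) ≤ ringKrullDim R) {i : ℕ} (hi : i ≤ t) :
    (headIdeal y i).IsPrime := by
  have hy : ∀ j < t, y j ∈ maximalIdeal R := fun j hj => hm ▸ mem_headIdeal y hj
  induction hi using Nat.decreasingInduction with
  | self => rw [← hm]; infer_instance
  | of_succ i hi ih =>
    obtain ⟨P, hP, hYP, hPd⟩ := (quotDimGE_headIdeal hy h hi.le).exists_prime
    have hN : maximalIdeal R ^ 1 ≤ headIdeal y t := by rw [pow_one, hm]
    have hn := not_quotDimGE_headIdeal hy hN (Nat.succ_le_of_lt hi)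
    have hyP : y i ∉ P := by
      intro hyi
      refine hn ((hPd.mono ?_).of_le (by omega))
      rw [headIdeal_succ]
      exact sup_le hYP ((Ideal.span_singleton_le_iff_mem _).2 hyi)
    have hPY : P ≤ headIdeal y (i + 1) := by
      by_contra hle
      refine hn ?_
      have h1 : QuotDimGE (t - (i + 1)) (P ⊔ Ideal.span {y i}) :=
        (hPd.of_le (by omega)).sup_span (hy i hi)
      refine QuotDimGE.succ_of_not_le hle (h1.mono ?_)
      rw [headIdeal_succ]
      exact sup_le (sup_le (hYP.trans le_sup_left) le_sup_right) le_sup_left |>.trans' (by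
        rw [sup_comm])
    have hPe : P ≤ headIdeal y i := by
      refine Submodule.le_of_le_smul_of_le_jacobson_bot (I := maximalIdeal R)
        (IsNoetherian.noetherian P) (IsLocalRing.maximalIdeal_le_jacobson _) ?_
      intro c hc
      have := hPY hc
      rw [headIdeal_succ] at this
      obtain ⟨g, hg⟩ := exists_of_mem_sup_span_singleton this
      have hgP : g ∈ P := by
        have : y i * g ∈ P := by
          have := P.sub_mem hc (hYP hg)
          simpa using this
        exact (hP.mem_or_mem this).resolve_left hyP
      have : c = (c - y i * g) + y i * g := by ring
      rw [this]
      exact Submodule.add_mem_sup hg (Submodule.smul_mem_smul (hy i hi) hgP)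
    rwa [← le_antisymm hPe hYP]

theorem headColon_le_headIdeal {t : ℕ} {y : ℕ → R} (hm : maximalIdeal R = headIdeal y t)
    (h : (t : WithBot ℕ∞) ≤ ringKrullDim R) {i : ℕ} (hi : i < t) :
    headColon y i ≤ headIdeal y i := by
  have hy : ∀ j < t, y j ∈ maximalIdeal R := fun j hj => hm ▸ mem_headIdeal y hj
  have hp := isPrime_headIdeal hm h hi.le
  intro c hc
  refine (hp.mem_or_mem (mem_headColon.1 hc)).resolve_left fun hyi => ?_
  have hN : maximalIdeal R ^ 1 ≤ headIdeal y t := by rw [pow_one, hm]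
  refine not_quotDimGE_headIdeal hy hN (Nat.succ_le_of_lt hi)
    (((quotDimGE_headIdeal hy h hi.le).mono ?_).of_le (by omega))
  rw [headIdeal_succ]
  exact sup_le le_rfl ((Ideal.span_singleton_le_iff_mem _).2 hyi)

theorem choose_le_of_pascal {G : ℕ → ℕ → ℕ∞} (h0 : ∀ n, 1 ≤ G n 0) (hz : ∀ k, 1 ≤ G 0 k)
    (hs : ∀ n k, G n (k + 1) + G (n + 1) k ≤ G (n + 1) (k + 1)) (n k : ℕ) :
    ((n + k).choose k : ℕ∞) ≤ G n k := by
  induction n generalizing k with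
  | zero => simpa using hz k
  | succ n ihn =>
    induction k with
    | zero => simpa using h0 (n + 1)
    | succ k ihk =>
      refine le_trans ?_ (hs n k)
      rw [show n + 1 + (k + 1) = (n + 1 + k) + 1 by ring, Nat.choose_succ_succ', Nat.cast_add,
        add_comm]
      refine add_le_add ?_ ihk
      have := ihn (k + 1)
      rwa [show n + (k + 1) = n + 1 + k by ring] at this

theorem choose_le_colen_maximalIdeal_pow {t : ℕ} {y : ℕ → R}
    (hm : maximalIdeal R = headIdeal y t) (h : (t : WithBot ℕ∞) ≤ ringKrullDim R) (n : ℕ) :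
    ((n + t).choose t : ℕ∞) ≤ colen (maximalIdeal R ^ (n + 1)) := by
  have hx : ∀ i < t, headColon y i ⊓ headIdeal y t ≤ headIdeal y i := fun i hi =>
    inf_le_left.trans (headColon_le_headIdeal hm h hi)
  let G : ℕ → ℕ → ℕ∞ := fun n k =>
    if k ≤ t then colen (maximalIdeal R ^ (n + 1) ⊔ headIdeal y (t - k)) else ⊤
  have hG : G n t = colen (maximalIdeal R ^ (n + 1)) := by simp [G, headIdeal_zero]
  rw [← hG]
  have h1 : ∀ n k, 1 ≤ G n k := by
    intro n k
    simp only [G]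
    split_ifs with hk
    · rw [← colen_maximalIdeal (R := R)]
      refine colen_anti (sup_le (Ideal.pow_le_self n.succ_ne_zero) ?_)
      rw [hm]
      exact headIdeal_mono y (Nat.sub_le _ _)
    · exact le_top
  refine choose_le_of_pascal (fun n => h1 n 0) (fun k => h1 0 k) (fun n k => ?_) n t
  simp only [G]
  by_cases hk : k + 1 ≤ t
  · have hi : t - (k + 1) < t := by omega
    rw [if_pos hk, if_pos (by omega : k ≤ t), if_pos hk,
      colen_eq_colon_add (maximalIdeal R ^ (n + 1 + 1) ⊔ headIdeal y (t - (k + 1))) (y (t - (k + 1)))]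
    refine add_le_add (colen_anti ?_) (colen_anti ?_)
    · have h2 := pow_sup_headColon_colon_le hx (n + 1) hi
      rw [le_antisymm (headColon_le_headIdeal hm h hi) (headIdeal_le_headColon y _), ← hm] at h2
      exact h2
    · rw [sup_assoc, ← headIdeal_succ, show t - (k + 1) + 1 = t - k by omega]
  · rw [if_neg hk, if_neg hk]
    exact le_top

end RegularLocal

section CurveBound

variable {R : Type*} [CommRing R]

theorem mul_colen_sup_span_le {Q : Ideal R} {y : R} (hQ : ∀ c, y * c ∈ Q → c ∈ Q) (s : ℕ) :
    (s : ℕ∞) * colen (Q ⊔ Ideal.span {y}) ≤ colen (Q ⊔ Ideal.span {y ^ s}) := by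
  induction s with
  | zero => simp
  | succ s ih =>
    rw [colen_eq_colon_add (Q ⊔ Ideal.span {y ^ (s + 1)}) y, Nat.cast_add, Nat.cast_one, add_mul,
      one_mul]
    refine add_le_add (ih.trans ?_) ?_
    · refine colen_anti fun c hc => ?_
      rw [Submodule.mem_colon_singleton, smul_eq_mul] at hc
      obtain ⟨g, hg⟩ := exists_of_mem_sup_span_singleton hc
      have h1 : c - y ^ s * g ∈ Q := hQ _ (by convert hg using 1; ring)
      have : c = (c - y ^ s * g) + y ^ s * g := by ring
      rw [this]
      exact Submodule.add_mem_sup h1 (Ideal.mul_mem_right _ _ (Ideal.mem_span_singleton_self _))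
    · refine colen_anti (sup_le (sup_le le_sup_left (le_sup_of_le_right ?_)) le_sup_right)
      exact Ideal.span_singleton_le_span_singleton.2 (dvd_pow_self y s.succ_ne_zero)

/-- Lower bound for the colength of the powers of `p + (y ^ s)` in terms of a filtration that
behaves like the symbolic powers of `p`. -/
theorem mul_choose_le_colen_sup_span_pow {p : Ideal R} {Q : ℕ → Ideal R} {y : R} {t : ℕ}
    (hQy : ∀ k c, y * c ∈ Q k → c ∈ Q k) (hQ0 : Q 0 = ⊤) (hQa : ∀ k, Q (k + 1) ≤ Q k)
    (hpQ : ∀ k, p * Q k ≤ Q (k + 1))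
    (hQc : ∀ k, ((k + t).choose t : ℕ∞) ≤ colen (Q (k + 1) ⊔ Ideal.span {y})) (s n : ℕ) :
    ((n + t + 1).choose (t + 1) : ℕ) * (s : ℕ∞) ≤ colen ((p ⊔ Ideal.span {y ^ s}) ^ (n + 1)) := by
  let Z : ℕ → Ideal R := fun n => Nat.rec ⊤ (fun n J => Ideal.span {y ^ s} * J ⊔ Q (n + 1)) n
  have hZ0 : Z 0 = ⊤ := rfl
  have hZs : ∀ n, Z (n + 1) = Ideal.span {y ^ s} * Z n ⊔ Q (n + 1) := fun n => rfl
  have hQZ : ∀ n, Q n ≤ Z n := by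
    intro n
    cases n with
    | zero => exact le_top
    | succ n => exact le_sup_right
  have hpZ : ∀ n, p * Z n ≤ Z (n + 1) := by
    intro n
    induction n with
    | zero => exact le_sup_of_le_right (by simpa [hZ0, hQ0] using hpQ 0)
    | succ n ih =>
      rw [hZs n, Ideal.mul_sup, hZs (n + 1)]
      refine sup_le_sup ?_ (hpQ _)
      rw [mul_left_comm]
      exact Ideal.mul_mono_right ih
  have hle : ∀ n, (p ⊔ Ideal.span {y ^ s}) ^ n ≤ Z n := by
    intro n
    induction n with
    | zero => exact le_top
    | succ n ih =>
      rw [pow_succ', Ideal.sup_mul]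
      refine sup_le ((Ideal.mul_mono_right ih).trans (hpZ n)) ?_
      exact (Ideal.mul_mono_right ih).trans le_sup_left
  have hys : ∀ k m c, y ^ m * c ∈ Q k → c ∈ Q k := by
    intro k m
    induction m with
    | zero => simp
    | succ m ih => exact fun c hc => ih c (hQy k _ (by convert hc using 1; ring))
  have hstep : ∀ n, colen (Z n) + ((n + t).choose t : ℕ∞) * s ≤ colen (Z (n + 1)) := by
    intro n
    rw [colen_eq_colon_add (Z (n + 1)) (y ^ s)]
    refine add_le_add (colen_anti ?_) ?_
    · intro c hc
      rw [Submodule.mem_colon_singleton, smul_eq_mul, hZs] at hc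
      obtain ⟨a, ha, b, hb, hab⟩ := Submodule.mem_sup.1 hc
      obtain ⟨g, hg, rfl⟩ := Ideal.mem_span_singleton_mul.1 ha
      have h1 : c - g ∈ Q (n + 1) := hys _ s _ (by
        have : y ^ s * (c - g) = b := by linear_combination -hab
        rwa [this])
      have := add_mem hg (hQZ n (hQa n h1))
      simpa using this
    · refine le_trans ?_ (colen_anti (sup_le (?_ : Z (n + 1) ≤ Q (n + 1) ⊔ Ideal.span {y ^ s})
        le_sup_right))
      · refine le_trans ?_ (mul_colen_sup_span_le (hQy _) s)
        rw [mul_comm]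
        gcongr
        exact hQc n
      · exact sup_le (Ideal.mul_le_left.trans le_sup_right) le_sup_left
  refine le_trans ?_ (colen_anti (hle (n + 1)))
  induction n with
  | zero =>
    have := hstep 0
    simp only [hZ0, colen_top, zero_add, Nat.choose_self, Nat.cast_one] at this
    simpa using this
  | succ n ih =>
    refine le_trans ?_ (hstep (n + 1))
    rw [show n + 1 + t + 1 = (n + t + 1) + 1 by ring, Nat.choose_succ_succ', Nat.cast_add, add_mul,
      add_comm, show n + 1 + t = n + t + 1 by ring]
    gcongr

theorem colen_le_colen_comap_sup_span [IsLocalRing R] [IsNoetherianRing R] {A : Type*} [CommRing A]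
    [Algebra R A] (M : Submonoid R) [IsLocalization M A] {y : R} (hyM : y ∈ M)
    (hy : y ∈ maximalIdeal R) (J : Ideal A) :
    colen J ≤ colen (J.comap (algebraMap R A) ⊔ Ideal.span {y}) := by
  set K := J.comap (algebraMap R A) ⊔ Ideal.span {y} with hK
  have hsat : ∀ (L : Ideal A) (c : R), y * c ∈ L.comap (algebraMap R A) →
      c ∈ L.comap (algebraMap R A) := by
    intro L c hc
    rw [Ideal.mem_comap, map_mul] at hc
    exact (Ideal.unit_mul_mem_iff_mem L (IsLocalization.map_units A ⟨y, hyM⟩)).1 hc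
  let g : Submodule A (A ⧸ J) → Ideal R := fun N =>
    Ideal.comap (algebraMap R A) (Submodule.comap J.mkQ N) ⊔ Ideal.span {y}
  have hgK : ∀ N, K ≤ g N := fun N => sup_le_sup_right (Ideal.comap_mono fun c hc => by
    rw [Submodule.mem_comap, Submodule.mkQ_apply, (Submodule.Quotient.mk_eq_zero J).2 hc]
    exact N.zero_mem) _
  have hgm : ∀ N N', N ≤ N' → g N ≤ g N' := fun N N' h =>
    sup_le_sup_right (Ideal.comap_mono (Submodule.comap_mono h)) _
  have hgi : ∀ N N', g N' ≤ g N → N ≤ N' → N' ≤ N := by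
    intro N N' h hle
    set a := Ideal.comap (algebraMap R A) (Submodule.comap J.mkQ N) with ha
    set a' := Ideal.comap (algebraMap R A) (Submodule.comap J.mkQ N') with ha'
    have haa : a ≤ a' := Ideal.comap_mono (Submodule.comap_mono hle)
    have h1 : a' ≤ a := by
      refine Submodule.le_of_le_smul_of_le_jacobson_bot (I := maximalIdeal R)
        (IsNoetherian.noetherian a') (IsLocalRing.maximalIdeal_le_jacobson _) ?_
      intro c hc
      obtain ⟨r, hr⟩ := exists_of_mem_sup_span_singleton (h (Submodule.mem_sup_left hc))
      have hra : r ∈ a' := hsat _ _ (by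
        have := sub_mem hc (haa hr)
        rwa [sub_sub_cancel] at this)
      have : c = (c - y * r) + y * r := by ring
      rw [this]
      exact Submodule.add_mem_sup hr (Submodule.smul_mem_smul hy hra)
    have h2 : (Submodule.comap J.mkQ N' : Ideal A) ≤ Submodule.comap J.mkQ N := by
      rw [← IsLocalization.map_under M A (Submodule.comap J.mkQ N' : Ideal A),
        ← IsLocalization.map_under M A (Submodule.comap J.mkQ N : Ideal A)]
      exact Ideal.map_mono h1
    intro c hc
    obtain ⟨c, rfl⟩ := Submodule.mkQ_surjective _ c
    exact h2 hc
  have hmono : StrictMono fun N : Submodule A (A ⧸ J) => Submodule.map K.mkQ (g N) := by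
    refine fun N N' h => lt_of_le_of_ne (Submodule.map_mono (hgm N N' h.le)) fun heq => ?_
    have h3 : g N = g N' := by
      have := congrArg (Submodule.comap K.mkQ) heq
      rwa [Submodule.comap_map_mkQ, Submodule.comap_map_mkQ, sup_eq_right.2 (hgK N),
        sup_eq_right.2 (hgK N')] at this
    exact h.not_ge (hgi N N' h3.ge h.le)
  have := Order.krullDim_le_of_strictMono _ hmono
  unfold colen
  rw [← Module.coe_length, ← Module.coe_length] at this
  exact_mod_cast this

variable [IsLocalRing R] [IsNoetherianRing R]

theorem exists_prime_le_height {N t : ℕ} {u : ℕ → R} (hu : ∀ j ≤ t, u j ∈ maximalIdeal R)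
    (hN : maximalIdeal R ^ N ≤ headIdeal u (t + 1))
    (hdim : ((t + 1 : ℕ) : WithBot ℕ∞) ≤ ringKrullDim R) {i : ℕ} (hi : i ≤ t) :
    ∃ P : Ideal R, P.IsPrime ∧ headIdeal u i ≤ P ∧ QuotDimGE (t + 1 - i) P ∧ i ≤ P.height := by
  induction i with
  | zero =>
    obtain ⟨P, hP, hle, hPd⟩ := (quotDimGE_bot.2 hdim).exists_prime
    exact ⟨P, hP, by simp [headIdeal_zero], hPd, by simp⟩
  | succ i ih =>
    obtain ⟨P, hP, hle, hPd, hPh⟩ := ih (by omega)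
    have h1 : QuotDimGE (t + 1 - (i + 1)) (P ⊔ Ideal.span {u i}) :=
      (hPd.of_le (by omega)).sup_span (hu i (by omega))
    obtain ⟨P', hP', hle', hPd'⟩ := h1.exists_prime
    have hui : u i ∉ P := by
      intro hui
      refine not_quotDimGE_headIdeal (fun j hj => hu j (by omega)) hN
        (by omega : i + 1 ≤ t + 1) ((hPd.mono ?_).of_le (by omega))
      rw [headIdeal_succ]
      exact sup_le hle ((Ideal.span_singleton_le_iff_mem _).2 hui)
    have hu' : u i ∈ P' := hle' (Submodule.mem_sup_right (Ideal.mem_span_singleton_self _))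
    refine ⟨P', hP', ?_, hPd', ?_⟩
    · rw [headIdeal_succ]
      exact (sup_le_sup_right hle _).trans hle'
    · have hlt : P < P' := lt_of_le_of_ne (le_sup_left.trans hle') fun h => hui (h ▸ hu')
      refine le_trans ?_ (Ideal.height_add_one_le_of_lt_of_isPrime hlt)
      push_cast
      gcongr

/-- If the last parameter `u t` factors as `y * z` with `z` in the socle modulo the parameters, then
`I = (u) : m` has the length function of an ideal whose first normalized Hilbert coefficient is
nonpositive. -/
theorem exists_colen_pow_bounds_of_factor {N t : ℕ} {u : ℕ → R}
    (hu : ∀ j ≤ t, u j ∈ maximalIdeal R) (hN : maximalIdeal R ^ N ≤ headIdeal u (t + 1))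
    (hdim : ((t + 1 : ℕ) : WithBot ℕ∞) ≤ ringKrullDim R) {y z : R} (hy : y ∈ maximalIdeal R)
    (hyz : u t = y * z) {I : Ideal R} (hzI : z ∈ I)
    (huI : headIdeal u t ≤ I) (hI : ∀ c ∈ I, ∀ r ∈ maximalIdeal R, r * c ∈ headIdeal u (t + 1)) :
    ∃ s w : ℕ, ∀ n, ((n + t + 1).choose (t + 1) : ℕ) * (s : ℕ∞) ≤ colen (I ^ (n + 1)) ∧
      colen (I ^ (n + 1)) ≤
        ((n + t + 1).choose (t + 1) : ℕ) * (s : ℕ∞) + ((n + t).choose t : ℕ) * (w : ℕ∞) := by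
  obtain ⟨p, hp, hYp, hpd, hph⟩ := exists_prime_le_height hu hN hdim le_rfl
  set Y := headIdeal u t with hY
  have hq : headIdeal u (t + 1) = Y ⊔ Ideal.span {y * z} := by rw [headIdeal_succ, hyz]
  rw [hq] at hN hI
  have hyzp : y * z ∉ p := by
    intro h
    refine not_quotDimGE_of_pow_le (hN.trans (sup_le hYp ?_)) (hpd.of_le (by omega))
    exact (Ideal.span_singleton_le_iff_mem _).2 h
  have hyp : y ∉ p := fun h => hyzp (Ideal.mul_mem_right _ _ h)
  have hzp : z ∉ p := fun h => hyzp (Ideal.mul_mem_left _ _ h)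
  -- the maximal ideal is generated by `y` and the elements carrying `z` into `Y`
  have hmem : ∀ r ∈ maximalIdeal R, ∃ g, (r - y * g) * z ∈ Y := by
    intro r hr
    obtain ⟨g, hg⟩ := exists_of_mem_sup_span_singleton (hI z hzI r hr)
    exact ⟨g, by convert hg using 1; ring⟩
  have hYcp : ∀ k c, c * z ^ k ∈ Y → c ∈ p := fun k c h =>
    (hp.mem_or_mem (hYp h)).resolve_right fun h' => hzp (hp.mem_of_pow_mem k h')
  have hmp : maximalIdeal R ≤ p ⊔ Ideal.span {y} := by
    intro r hr
    obtain ⟨g, hg⟩ := hmem r hr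
    have : r = (r - y * g) + y * g := by ring
    rw [this]
    exact Submodule.add_mem_sup (hYcp 1 _ (by simpa using hg))
      (Ideal.mul_mem_right _ _ (Ideal.mem_span_singleton_self _))
  have hcol : p ≤ Y.colon {z} := by
    refine Submodule.le_of_le_smul_of_le_jacobson_bot (I := maximalIdeal R)
      (IsNoetherian.noetherian p) (IsLocalRing.maximalIdeal_le_jacobson _) ?_
    intro c hc
    obtain ⟨g, hg⟩ := hmem c (le_maximalIdeal hp.ne_top hc)
    have h1 : c - y * g ∈ Y.colon {z} := Submodule.mem_colon_singleton.2 hg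
    have hgp : g ∈ p := by
      have : y * g ∈ p := by
        have := sub_mem hc (hYcp 1 (c - y * g) (by simpa using hg))
        simpa using this
      exact (hp.mem_or_mem this).resolve_left hyp
    have : c = (c - y * g) + y * g := by ring
    rw [this]
    exact Submodule.add_mem_sup h1 (Submodule.smul_mem_smul hy hgp)
  have hpY : Y.colon {z ^ 1} = p := le_antisymm
    (fun c hc => hYcp 1 c (Submodule.mem_colon_singleton.1 hc)) (by simpa using hcol)
  have hex : ∃ n, z ∉ p ⊔ Ideal.span {y ^ n} := by
    refine ⟨N, fun h => ?_⟩
    have h1 : z ∈ p ⊔ Ideal.span {y * z} := by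
      refine (sup_le le_sup_left ?_ : p ⊔ Ideal.span {y ^ N} ≤ _) h
      rw [Ideal.span_singleton_le_iff_mem]
      exact sup_le_sup_right hYp _ (hN (Ideal.pow_mem_pow hy N))
    obtain ⟨g, hg⟩ := exists_of_mem_sup_span_singleton h1
    have h2 : z * (1 - y * g) ∈ p := by convert hg using 1; ring
    refine (hp.mem_or_mem h2).elim hzp fun h3 => ?_
    have h4 := add_mem (le_maximalIdeal hp.ne_top h3) (Ideal.mul_mem_right g _ hy)
    rw [sub_add_cancel] at h4
    exact (Ideal.ne_top_iff_one _).1 (IsLocalRing.maximalIdeal.isMaximal R).ne_top h4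
  obtain ⟨s, hs1, hs2⟩ : ∃ s, z ∈ p ⊔ Ideal.span {y ^ s} ∧ z ∉ p ⊔ Ideal.span {y ^ (s + 1)} := by
    classical
    have h0 : Nat.find hex ≠ 0 := fun h => by
      have := Nat.find_spec hex
      simp [h] at this
    refine ⟨Nat.find hex - 1, ?_, ?_⟩
    · exact not_not.1 (Nat.find_min hex (by omega))
    · rw [Nat.sub_add_cancel (by omega)]
      exact Nat.find_spec hex
  have hsz : y ^ s ∈ p ⊔ Ideal.span {z} := by
    obtain ⟨g, hg⟩ := exists_of_mem_sup_span_singleton hs1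
    have hgu : IsUnit g := by
      by_contra hgu
      apply hs2
      obtain ⟨r, hr⟩ := exists_of_mem_sup_span_singleton (hmp ((mem_maximalIdeal g).2 hgu))
      have : z = (z - y ^ s * g + y ^ s * (g - y * r)) + y ^ (s + 1) * r := by ring
      rw [this]
      exact Submodule.add_mem_sup (add_mem hg (Ideal.mul_mem_left _ _ hr))
        (Ideal.mul_mem_right _ _ (Ideal.mem_span_singleton_self _))
    obtain ⟨g', hg'⟩ := hgu.exists_right_inv
    have : y ^ s = -((z - y ^ s * g) * g') + z * g' := by linear_combination (-y ^ s) * hg'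
    rw [this]
    exact Submodule.add_mem_sup (neg_mem (Ideal.mul_mem_right _ _ hg))
      (Ideal.mul_mem_right _ _ (Ideal.mem_span_singleton_self _))
  have hIp : I ≤ p ⊔ Ideal.span {y ^ s} := by
    intro c hc
    obtain ⟨g, hg⟩ := exists_of_mem_sup_span_singleton (hI c hc y hy)
    have h1 : c - z * g ∈ p :=
      (hp.mem_or_mem (by convert hYp hg using 1; ring : y * (c - z * g) ∈ p)).resolve_left hyp
    have : c = (c - z * g) + z * g := by ring
    rw [this]
    exact add_mem (Submodule.mem_sup_left h1) (Ideal.mul_mem_right _ _ hs1)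
  have hfin : colen (Y ⊔ Ideal.span {z ^ 1}) ≠ ⊤ := by
    refine colen_ne_top (hN.trans (sup_le_sup_left ?_ _))
    rw [pow_one]
    exact Ideal.span_singleton_le_span_singleton.2 (dvd_mul_left z y)
  obtain ⟨w, hw⟩ := ENat.ne_top_iff_exists.1 hfin
  refine ⟨s, w, fun n => ⟨?_, ?_⟩⟩
  · refine le_trans ?_ (colen_anti (Ideal.pow_right_mono hIp _))
    let A := Localization.AtPrime p
    let f := algebraMap R A
    have hmA : maximalIdeal A = headIdeal (f ∘ u) t := by
      have hh : headIdeal (f ∘ u) t = Y.map f := by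
        rw [hY, headIdeal, headIdeal, Ideal.map_span, Set.image_comp]
      rw [hh, ← Localization.AtPrime.map_eq_maximalIdeal]
      refine le_antisymm (Ideal.map_le_iff_le_comap.2 fun c hc => ?_) (Ideal.map_mono hYp)
      have h1 := Ideal.mem_map_of_mem f (Submodule.mem_colon_singleton.1 (hcol hc))
      rw [smul_eq_mul, mul_comm, map_mul] at h1
      exact (Ideal.unit_mul_mem_iff_mem _
        (IsLocalization.map_units A (⟨z, hzp⟩ : p.primeCompl))).1 h1
    have hdA : (t : WithBot ℕ∞) ≤ ringKrullDim A := by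
      rw [IsLocalization.AtPrime.ringKrullDim_eq_height p A]
      exact_mod_cast hph
    have hmap : p.map f = maximalIdeal A := Localization.AtPrime.map_eq_maximalIdeal
    refine mul_choose_le_colen_sup_span_pow (Q := fun k => (maximalIdeal A ^ k).comap f)
      (fun k c hc => ?_) (by simp) (fun k => Ideal.comap_mono (Ideal.pow_le_pow_right k.le_succ))
      (fun k => ?_) (fun k => ?_) s n
    · rw [Ideal.mem_comap, map_mul] at hc
      exact (Ideal.unit_mul_mem_iff_mem _
        (IsLocalization.map_units A (⟨y, hyp⟩ : p.primeCompl))).1 hc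
    · rw [← Ideal.map_le_iff_le_comap, Ideal.map_mul, hmap, pow_succ']
      exact Ideal.mul_mono_right Ideal.map_comap_le
    · exact (choose_le_colen_maximalIdeal_pow hmA hdA k).trans
        (colen_le_colen_comap_sup_span p.primeCompl hyp hy _)
  · have hle : Y ⊔ Ideal.span {z} ≤ I := sup_le huI ((Ideal.span_singleton_le_iff_mem _).2 hzI)
    refine (colen_anti (Ideal.pow_right_mono hle _)).trans
      (colen_pow_le (M := 1) ?_ (by rw [hw]) n)
    rw [hpY]
    refine (colen_anti (sup_le le_sup_left ((Ideal.span_singleton_le_iff_mem _).2 hsz) :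
      p ⊔ Ideal.span {y ^ s} ≤ _)).trans ?_
    have := colen_sup_span_pow_le (Y := p) (z := y) (M := 0) (s := 1) (w := 0)
      (by
        rw [← colen_maximalIdeal (R := R)]
        refine colen_anti (hmp.trans (sup_le_sup_right ?_ _))
        intro c hc
        rw [Submodule.mem_colon_singleton]
        simpa using hc)
      (by simp [colen_top]) s
    simpa using this

end CurveBound

section Replacement

variable {R : Type*} [CommRing R] [IsLocalRing R]

/-- An element of an ideal `q` outside `m q` can be taken as the last generator of `q`. -/
theorem exists_headIdeal_eq_of_notMem {k : ℕ} {x : ℕ → R} {v : R} (hv : v ∈ headIdeal x (k + 1))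
    (hv' : v ∉ maximalIdeal R * headIdeal x (k + 1)) :
    ∃ u : ℕ → R, u k = v ∧ headIdeal u (k + 1) = headIdeal x (k + 1) := by
  induction k generalizing v with
  | zero =>
    rw [headIdeal_succ, headIdeal_zero, bot_sup_eq] at hv hv'
    refine ⟨Function.update x 0 v, by simp, ?_⟩
    rw [headIdeal_succ, headIdeal_succ, headIdeal_zero, headIdeal_zero, bot_sup_eq, bot_sup_eq,
      Function.update_self]
    obtain ⟨g, rfl⟩ := Ideal.mem_span_singleton'.1 hv
    have hg : IsUnit g := by
      by_contra hg
      exact hv' (Ideal.mul_mem_mul ((mem_maximalIdeal g).2 hg) (Ideal.mem_span_singleton_self _))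
    exact Ideal.span_singleton_mul_left_unit hg _
  | succ k ih =>
    rw [headIdeal_succ] at hv
    obtain ⟨g, hg⟩ := exists_of_mem_sup_span_singleton hv
    set w := v - x (k + 1) * g with hw
    by_cases hgu : IsUnit g
    · refine ⟨Function.update x (k + 1) v, by simp, ?_⟩
      have hc : headIdeal (Function.update x (k + 1) v) (k + 1) = headIdeal x (k + 1) :=
        headIdeal_congr fun j hj => Function.update_of_ne (by omega) ..
      rw [headIdeal_succ _ (k + 1), headIdeal_succ x (k + 1), hc, Function.update_self]
      refine le_antisymm (sup_le le_sup_left ((Ideal.span_singleton_le_iff_mem _).2 hv))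
        (sup_le le_sup_left ((Ideal.span_singleton_le_iff_mem _).2 ?_))
      obtain ⟨g', hg'⟩ := hgu.exists_right_inv
      have : x (k + 1) = -(w * g') + v * g' := by
        rw [hw]
        linear_combination (-x (k + 1)) * hg'
      rw [this]
      exact Submodule.add_mem_sup (neg_mem (Ideal.mul_mem_right _ _ hg))
        (Ideal.mul_mem_right _ _ (Ideal.mem_span_singleton_self _))
    · have hw' : w ∉ maximalIdeal R * headIdeal x (k + 1) := by
        intro h
        apply hv'
        have : v = w + g * x (k + 1) := by rw [hw]; ring
        rw [this]
        exact add_mem (Ideal.mul_mono_right (headIdeal_mono x (Nat.le_succ _)) h)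
          (Ideal.mul_mem_mul ((mem_maximalIdeal g).2 hgu) (mem_headIdeal x (Nat.lt_succ_self _)))
      obtain ⟨u, huk, hu⟩ := ih hg hw'
      refine ⟨Function.update (Function.update u k (x (k + 1))) (k + 1) v, by simp, ?_⟩
      rw [headIdeal_succ _ (k + 1), headIdeal_succ _ k, headIdeal_succ x (k + 1), ← hu,
        headIdeal_succ u k, huk, Function.update_self,
        headIdeal_congr (y := u) (fun j hj => by
          rw [Function.update_of_ne (by omega), Function.update_of_ne (by omega)]),
        Function.update_of_ne (by omega : k ≠ k + 1), Function.update_self]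
      have hv2 : v = w + x (k + 1) * g := by rw [hw]; ring
      refine le_antisymm (sup_le (sup_le (le_sup_of_le_left le_sup_left) le_sup_right) ?_)
        (sup_le (sup_le (le_sup_of_le_left le_sup_left) ?_) (le_sup_of_le_left le_sup_right))
      · rw [Ideal.span_singleton_le_iff_mem, hv2]
        exact add_mem (Submodule.mem_sup_left (Submodule.mem_sup_right
          (Ideal.mem_span_singleton_self _))) (Ideal.mul_mem_right _ _ (Submodule.mem_sup_right
            (Ideal.mem_span_singleton_self _)))
      · rw [Ideal.span_singleton_le_iff_mem, hw]
        exact sub_mem (Submodule.mem_sup_right (Ideal.mem_span_singleton_self _))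
          (Ideal.mul_mem_right _ _ (Submodule.mem_sup_left (Submodule.mem_sup_right
            (Ideal.mem_span_singleton_self _))))

variable [IsNoetherianRing R]

theorem IsKillingSystem.exists_colen_pow_bounds {x : ℕ → R} {D M : ℕ} {b : ℕ → Ideal R}
    (h : IsKillingSystem x (D + 1) b) (hM : maximalIdeal R ^ M ≤ headIdeal x (D + 1))
    (hdim : ((D + 1 : ℕ) : WithBot ℕ∞) ≤ ringKrullDim R) {I : Ideal R}
    (hI : I = (headIdeal x (D + 1)).colon (maximalIdeal R : Set R)) {N : ℕ}
    (hN : Module.length R (Submodule.map (headIdeal x (D + 1)).mkQ I) = N) :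
    ∃ E w : ℕ, ∀ n,
      ((n + D + 1).choose (D + 1) : ℕ) * (E : ℕ∞) ≤
        colen (I ^ (n + 1)) + ((n + D).choose D : ℕ) * (N : ℕ∞) ∧
      colen (I ^ (n + 1)) ≤
        ((n + D + 1).choose (D + 1) : ℕ) * (E : ℕ∞) + ((n + D).choose D : ℕ) * (w : ℕ∞) := by
  set q := headIdeal x (D + 1) with hq
  have hqI : q ≤ I := hI ▸ Ideal.le_colon
  have hqm : q ≤ maximalIdeal R := Ideal.span_le.2 (by
    rintro _ ⟨j, hj, rfl⟩
    exact h.mem_maximalIdeal j hj)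
  have hImem : ∀ c ∈ I, ∀ r ∈ maximalIdeal R, r * c ∈ q := by
    intro c hc r hr
    rw [hI, Submodule.mem_colon] at hc
    simpa [mul_comm] using hc r hr
  by_cases hcase : maximalIdeal R * I ≤ maximalIdeal R * q
  · have hEfin : colen (q ⊔ headColon x D) ≠ ⊤ := colen_ne_top (hM.trans le_sup_left)
    obtain ⟨E, hE⟩ := ENat.ne_top_iff_exists.1 hEfin
    have hw : colen (headIdeal x D ⊔ Ideal.span {x D ^ 1}) ≠ ⊤ := by
      rw [pow_one, ← headIdeal_succ]
      exact colen_ne_top hM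
    obtain ⟨w, hw⟩ := ENat.ne_top_iff_exists.1 hw
    refine ⟨E, w, fun n => ⟨?_, ?_⟩⟩
    · rw [hE]
      refine h.mul_choose_le_colen_pow (fun n => ?_) ?_ n
      · have : ∀ n, maximalIdeal R * I ^ n ≤ maximalIdeal R * q ^ n := by
          intro n
          induction n with
          | zero => simp
          | succ n ih =>
            rw [pow_succ, ← mul_assoc]
            refine (Ideal.mul_mono_left ih).trans ?_
            rw [mul_right_comm]
            refine (Ideal.mul_mono_left hcase).trans ?_
            rw [mul_assoc, ← pow_succ']
        exact (this _).trans Ideal.mul_le_right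
      · have h1 := colen_sup_add_le hqI (headColon x D)
        rw [colen_eq_length_map_add hqI, hN, ← add_assoc] at h1
        have h2 := (ENat.add_le_add_iff_right (colen_ne_top (hM.trans hqI))).1 h1
        refine h2.trans ?_
        gcongr
        refine colen_anti ?_
        rw [hI]
        exact h.colon_maximalIdeal_le
    · refine (colen_anti (Ideal.pow_right_mono hqI _)).trans ?_
      rw [hq, headIdeal_succ]
      refine colen_pow_le (M := 1) ?_ (by rw [hw]) n
      rw [hE]
      refine colen_anti ?_
      rw [hq, headIdeal_succ, pow_one]
      exact sup_le (sup_le ((headIdeal_le_headColon x D).trans le_sup_left) le_sup_right)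
        le_sup_left
  · obtain ⟨y, hy, z, hz, hyz⟩ : ∃ y ∈ maximalIdeal R, ∃ z ∈ I, y * z ∉ maximalIdeal R * q := by
      by_contra! hcon
      exact hcase (Ideal.mul_le.2 hcon)
    obtain ⟨u, huD, hu⟩ := exists_headIdeal_eq_of_notMem (hImem z hz y hy) hyz
    obtain ⟨s, w, hsw⟩ := exists_colen_pow_bounds_of_factor (N := M) (t := D) (u := u)
      (fun j hj => hqm (hu.le (mem_headIdeal u (by omega)))) (hu ▸ hM) hdim hy huD hz
      ((headIdeal_mono u (Nat.le_succ D)).trans (hu.le.trans hqI)) (hu ▸ hImem)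
    exact ⟨s, w, fun n => ⟨(hsw n).1.trans le_self_add, (hsw n).2⟩⟩

end Replacement

section Translation

variable {R : Type u} [CommRing R]

theorem mk_mk_smul_top_eq_zero_iff (J H : Ideal R) (c : R) :
    (Submodule.Quotient.mk (Submodule.Quotient.mk c : R ⧸ J) :
      (R ⧸ J) ⧸ (H • (⊤ : Submodule R (R ⧸ J)))) = 0 ↔ c ∈ H ⊔ J := by
  have h1 : H • (⊤ : Submodule R (R ⧸ J)) = Submodule.map J.mkQ H := by
    rw [← Submodule.range_mkQ J, ← Submodule.map_top, ← Submodule.map_smul'', smul_eq_mul,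
      Ideal.mul_top]
  rw [Submodule.Quotient.mk_eq_zero, h1, ← Submodule.mkQ_apply, ← Submodule.mem_comap,
    Submodule.comap_map_mkQ, sup_comm]

variable [IsLocalRing R] [IsNoetherianRing R]

theorem mul_mem_of_mem_bIdeal {J : Ideal R} {l N : ℕ} {u : ℕ → R}
    (hu : ∀ j ≤ l, u j ∈ maximalIdeal R) (hJ : ringKrullDim (R ⧸ J) = ((l + 1 : ℕ) : WithBot ℕ∞))
    (hN : maximalIdeal R ^ N ≤ headIdeal u (l + 1) ⊔ J) {i : ℕ} (hi : i ≤ l) {c : R}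
    (hc : u i * c ∈ headIdeal u i ⊔ J) {β : R} (hβ : β ∈ bIdeal R (R ⧸ J)) :
    β * c ∈ headIdeal u i ⊔ J := by
  let v : Fin (l + 1) → R := fun j => u j
  have hrange : Ideal.span (Set.range v) = headIdeal u (l + 1) := by
    rw [headIdeal]
    congr 1
    ext r
    constructor
    · rintro ⟨j, rfl⟩
      exact ⟨j, j.2, rfl⟩
    · rintro ⟨j, hj, rfl⟩
      exact ⟨⟨j, hj⟩, rfl⟩
  let k : Fin (l + 1) := ⟨i, by omega⟩
  have hhead : Ideal.span (v '' {j | j < k}) = headIdeal u i := by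
    rw [headIdeal]
    congr 1
    ext r
    constructor
    · rintro ⟨j, hj, rfl⟩
      exact ⟨j, hj, rfl⟩
    · rintro ⟨j, hj, rfl⟩
      have hj' : j < i := hj
      exact ⟨⟨j, by omega⟩, hj, rfl⟩
  have hsop : IsSOP R (R ⧸ J) v := by
    refine ⟨?_, fun j => (mem_maximalIdeal _).1 (hu j (by omega)), ?_⟩
    · rw [moduleDim, Ideal.annihilator_quotient, hJ]
    · rw [hrange, ← Module.length_ne_top_iff]
      refine ne_top_of_le_ne_top (colen_ne_top hN) ?_
      let f := (Submodule.mkQ (headIdeal u (l + 1) • (⊤ : Submodule R (R ⧸ J)))) ∘ₗ J.mkQ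
      refine Module.length_le_of_surjective
        (Submodule.liftQ (headIdeal u (l + 1) ⊔ J) f fun r hr => ?_) ?_
      · exact (mk_mk_smul_top_eq_zero_iff J _ r).2 hr
      · intro r
        obtain ⟨r, rfl⟩ := Submodule.Quotient.mk_surjective _ r
        obtain ⟨r, rfl⟩ := Submodule.Quotient.mk_surjective _ r
        exact ⟨Submodule.Quotient.mk r, rfl⟩
  simp only [bIdeal, Submodule.mem_iInf] at hβ
  have h1 := hβ (l + 1) v hsop k
  rw [hhead] at h1
  have h2 := Module.mem_annihilator.1 h1 ⟨Submodule.Quotient.mk (Submodule.Quotient.mk c), by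
    rw [Submodule.mem_torsionBy_iff]
    exact (mk_mk_smul_top_eq_zero_iff J _ (u i * c)).2 hc⟩
  rw [Subtype.ext_iff] at h2
  exact (mk_mk_smul_top_eq_zero_iff J _ (β * c)).1 h2

theorem isKillingSystem_bIdeal {x : ℕ → R} {d N : ℕ} (hx : ∀ j < d, x j ∈ maximalIdeal R)
    (hdim : ringKrullDim R = (d : WithBot ℕ∞)) (hN : maximalIdeal R ^ N ≤ headIdeal x d)
    (hb : ∀ l < d, x l ∈ bIdeal R (R ⧸ tailIdeal x (l + 1) d) ^ 3) :
    IsKillingSystem x d fun l => bIdeal R (R ⧸ tailIdeal x (l + 1) d) := by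
  refine ⟨hx, hb, fun l hl u hu hsq i hi c hc β hβ => ?_⟩
  set J := tailIdeal x (l + 1) d with hJ
  have hrad : maximalIdeal R ≤ (headIdeal u (l + 1) ⊔ J).radical := by
    have hq : headIdeal x d ≤ (headIdeal u (l + 1) ⊔ J).radical := Ideal.span_le.2 (by
      rintro _ ⟨j, hj, rfl⟩
      exact ⟨2, hsq j hj⟩)
    intro r hr
    rw [← Ideal.radical_idem]
    exact ⟨N, hq (hN (Ideal.pow_mem_pow hr N))⟩
  obtain ⟨k, hk⟩ := Ideal.exists_pow_le_of_le_radical_of_fg hrad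
    (IsNoetherian.noetherian (maximalIdeal R))
  refine mul_mem_of_mem_bIdeal hu ?_ hk hi hc hβ
  have hge : QuotDimGE (l + 1) J := by
    have hJ' : J = headIdeal (fun j => x (l + 1 + j)) (d - (l + 1)) := by
      rw [hJ, tailIdeal, headIdeal]
      congr 1
      ext r
      constructor
      · rintro ⟨j, hj, rfl⟩
        obtain ⟨hj1, hj2⟩ := hj
        exact ⟨j - (l + 1), Set.mem_Iio.2 (by omega), by
          show x (l + 1 + (j - (l + 1))) = x j
          congr 1; omega⟩
      · rintro ⟨j, hj, rfl⟩
        rw [Set.mem_Iio] at hj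
        exact ⟨l + 1 + j, ⟨by omega, by omega⟩, rfl⟩
    have h0 : QuotDimGE (l + 1 + (d - (l + 1))) (⊥ : Ideal R) := by
      rw [quotDimGE_bot, hdim, Nat.add_sub_cancel' (by omega)]
    have := h0.sup_headIdeal (u := fun j => x (l + 1 + j)) fun j hj => hx _ (by omega)
    rwa [bot_sup_eq, ← hJ'] at this
  have hlt : ¬ QuotDimGE (l + 1 + 1) J := by
    intro h
    have h' : QuotDimGE (1 + (l + 1)) J := h.of_le (by omega)
    refine not_quotDimGE_of_pow_le hk ?_
    rw [sup_comm]
    exact h'.sup_headIdeal fun j hj => hu j (by omega)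
  unfold QuotDimGE at hge hlt
  generalize ringKrullDim (R ⧸ J) = a at hge hlt
  refine le_antisymm ?_ hge
  rw [not_le] at hlt
  induction a with
  | bot => exact bot_le
  | coe a =>
    norm_cast at hlt ⊢
    rw [Nat.cast_add (l + 1), Nat.cast_one] at hlt
    exact (ENat.lt_add_one_iff (ENat.natCast_ne_top _)).1 hlt

end Translation

/-- For `R` unmixed of dimension `d ≥ 2`, `e_1(q :_R m, R) ≤ 𝒩(R)` for every
C-parameter ideal `q` of `R`, i.e. `Ξ_1(R) ⊆ (-∞, 𝒩(R)]`. -/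
theorem statement_5 {R : Type u} [CommRing R] [IsLocalRing R] [IsNoetherianRing R]
    (hres : IsHomImageOfCM R)
    (d : ℕ) (hd : 2 ≤ d) (hdim : ringKrullDim R = (d : WithBot ℕ∞))
    (hum : IsUnmixedRing R)
    (NR : ℕ) (hNR : IsStableValue R NR) :
    ∀ q : Ideal R, IsCParamIdeal R q →
      ∀ e : ℕ → ℤ, IsHilbCoeff R (colonIdeal R q) d e → e 1 ≤ (NR : ℤ) := by
  intro q hq e he
  have hir := hNR q hq
  obtain ⟨s, x, ⟨⟨hs, hxm, hfl⟩, hC⟩, hqx⟩ := hq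
  have hsm : ∀ K : Ideal R, K • (⊤ : Submodule R R) = K := fun K => by
    rw [smul_eq_mul, Ideal.mul_top]
  have hds : s = d := by
    have h1 : Module.annihilator R R = ⊥ := Module.annihilator_eq_bot.2 inferInstance
    rw [moduleDim, h1, ringKrullDim_eq_of_ringEquiv (RingEquiv.quotientBot R), hdim] at hs
    exact_mod_cast hs.symm
  subst hds
  let X : ℕ → R := fun j => if h : j < s then x ⟨j, h⟩ else 0
  have hX : ∀ j : Fin s, X j = x j := fun j => dif_pos j.2
  have hqX : q = headIdeal X s := by
    rw [hqx, headIdeal]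
    congr 1
    ext r
    constructor
    · rintro ⟨j, rfl⟩
      exact ⟨j, j.2, hX j⟩
    · rintro ⟨j, hj, rfl⟩
      exact ⟨⟨j, hj⟩, (hX ⟨j, hj⟩).symm⟩
  have htail : ∀ i : Fin s, Ideal.span (x '' {j | i < j}) = tailIdeal X (i + 1) s := by
    intro i
    rw [tailIdeal]
    congr 1
    ext r
    constructor
    · rintro ⟨j, hj, rfl⟩
      exact ⟨j, ⟨hj, j.2⟩, hX j⟩
    · rintro ⟨j, ⟨hj, hj'⟩, rfl⟩
      exact ⟨⟨j, hj'⟩, hj, (hX ⟨j, hj'⟩).symm⟩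
  have hXm : ∀ j < s, X j ∈ maximalIdeal R := fun j hj => by
    rw [hX ⟨j, hj⟩]
    exact (mem_maximalIdeal _).2 (hxm ⟨j, hj⟩)
  rw [hsm, ← hqx, hqX] at hfl
  obtain ⟨M, hM⟩ := exists_pow_le_of_isFiniteLength hfl
  have hK := isKillingSystem_bIdeal hXm hdim hM fun l hl => by
    have := hC ⟨l, hl⟩
    rw [hsm, htail, ← hX] at this
    exact this
  obtain ⟨D, rfl⟩ : ∃ D, s = D + 1 := ⟨s - 1, by omega⟩
  have hI : colonIdeal R q = (headIdeal X (D + 1)).colon (maximalIdeal R : Set R) := by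
    ext c
    rw [Submodule.mem_colon, ← hqX]
    exact forall₂_congr fun r _ => by rw [smul_eq_mul, smul_eq_mul, mul_comm]
  have hlen : Module.length R (Submodule.map (headIdeal X (D + 1)).mkQ (colonIdeal R q)) = NR := by
    rw [irMod, hsm, moduleLength, ← Module.coe_length] at hir
    rw [← hqX]
    exact_mod_cast hir
  obtain ⟨E, w, hEw⟩ := hK.exists_colen_pow_bounds hM hdim.ge hI hlen
  obtain ⟨n₀, he⟩ := he
  have he' : ∀ n ≥ n₀, ∃ L : ℕ, colen (colonIdeal R q ^ (n + 1)) = L ∧ (L : ℤ) =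
      ∑ i ∈ Finset.range (D + 1 + 1), (-1) ^ i * e i * ((n + (D + 1) - i).choose (D + 1 - i) : ℤ) := by
    intro n hn
    obtain ⟨L, hL, hL'⟩ := he n hn
    rw [hsm, moduleLength, ← Module.coe_length] at hL
    exact ⟨L, by exact_mod_cast hL, hL'⟩
  choose! L hL hL' using he'
  refine hilbert_coeff_one_le (d := D + 1) (L := L) (E := E) (w := w) (n₀ := n₀) (by omega)
    (fun n hn => ?_) (fun n hn => ?_) hL'
  · have := (hEw n).1
    rw [hL n hn] at this
    norm_cast at this
    rw [mul_comm E, mul_comm NR]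
    exact this
  · have := (hEw n).2
    rw [hL n hn] at this
    norm_cast at this
    rw [mul_comm E, mul_comm w]
    exact this
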